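/- arXiv:2207.07442 — 2 statements merged into one kernel-verified Lean document; each statement's English description precedes it below -/
import Mathlib

section
/- There is an absolute constant C > 0 such that the following holds. Let T = {τ_1,…,τ_n} be a set of n polygonal curves in ℝ^d, each of complexity at most m, with n·m ≥ 2, and let ε ∈ (0,1). Then there exists a linear map f : ℝ^d → ℝ^{d′} with d′ ≤ ⌈C·ε^{−2}·log(nm)⌉ such that for all σ, τ ∈ T: |d_F(σ,τ) − d_F(F(σ), F(τ))| ≤ ε·d_F(σ,τ) and |d_wF(σ,τ) − d_wF(F(σ), F(τ))| ≤ ε·d_wF(σ,τ). -/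
open scoped Classical RealInnerProductSpace

noncomputable section

/-- A polygonal curve in `ℝ^d`: vertices `v_1, …, v_m`, instants `0 = t_1 < … < t_m = 1`,
and a parameterization `toFun : [0,1] → ℝ^d` that interpolates affinely (traces the line
segment) between consecutive vertices.  `m` is the complexity of the curve. -/
structure PolyCurve (d : ℕ) where
  m : ℕ
  m_pos : 0 < m
  vertex : Fin m → EuclideanSpace ℝ (Fin d)
  instant : Fin m → ℝ
  toFun : ℝ → EuclideanSpace ℝ (Fin d)
  instant_strictMono : StrictMono instant
  instant_first : instant ⟨0, m_pos⟩ = 0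
  instant_last : instant ⟨m - 1, Nat.sub_lt m_pos one_pos⟩ = 1
  affine_on_segments : ∀ i j : Fin m, (j : ℕ) = (i : ℕ) + 1 → ∀ s ∈ Set.Icc (0:ℝ) 1,
    toFun ((1 - s) * instant i + s * instant j) = (1 - s) • vertex i + s • vertex j

/-- The image curve `F(τ)` under a linear map `f`: same instants, vertices `f(v_i)`,
parameterization `f ∘ τ`. -/
def PolyCurve.map {d d' : ℕ} (f : EuclideanSpace ℝ (Fin d) →ₗ[ℝ] EuclideanSpace ℝ (Fin d'))
    (τ : PolyCurve d) : PolyCurve d' where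
  m := τ.m
  m_pos := τ.m_pos
  vertex := fun i => f (τ.vertex i)
  instant := τ.instant
  toFun := fun t => f (τ.toFun t)
  instant_strictMono := τ.instant_strictMono
  instant_first := τ.instant_first
  instant_last := τ.instant_last
  affine_on_segments := by
    intro i j hj s hs
    simp only [τ.affine_on_segments i j hj s hs, map_add, map_smul]

/-- A weak reparameterization: a continuous map of `[0,1]` to itself fixing the endpoints. -/
def IsWeakReparam (φ : ℝ → ℝ) : Prop :=
  ContinuousOn φ (Set.Icc 0 1) ∧ Set.MapsTo φ (Set.Icc 0 1) (Set.Icc 0 1) ∧ φ 0 = 0 ∧ φ 1 = 1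

/-- A reparameterization: a continuous bijection of `[0,1]` onto itself fixing the endpoints. -/
def IsReparam (φ : ℝ → ℝ) : Prop :=
  IsWeakReparam φ ∧ Set.BijOn φ (Set.Icc 0 1) (Set.Icc 0 1)

/-- The (continuous) Fréchet distance between two polygonal curves. -/
def frechetDist {d : ℕ} (σ τ : PolyCurve d) : ℝ :=
  sInf { r | ∃ φ ψ : ℝ → ℝ, IsReparam φ ∧ IsReparam ψ ∧
    r = ⨆ t : Set.Icc (0:ℝ) 1, ‖σ.toFun (φ t.1) - τ.toFun (ψ t.1)‖ }

/-- The weak Fréchet distance between two polygonal curves. -/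
def weakFrechetDist {d : ℕ} (σ τ : PolyCurve d) : ℝ :=
  sInf { r | ∃ φ ψ : ℝ → ℝ, IsWeakReparam φ ∧ IsWeakReparam ψ ∧
    r = ⨆ t : Set.Icc (0:ℝ) 1, ‖σ.toFun (φ t.1) - τ.toFun (ψ t.1)‖ }

/-- `f` is a `(1 ± ε)`-embedding for the point set `P`. -/
def IsJLEmbedding {d d' : ℕ} (ε : ℝ) (f : EuclideanSpace ℝ (Fin d) → EuclideanSpace ℝ (Fin d'))
    (P : Set (EuclideanSpace ℝ (Fin d))) : Prop :=
  ∀ p ∈ P, ∀ q ∈ P,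
    (1 - ε) * ‖p - q‖ ≤ ‖f p - f q‖ ∧ ‖f p - f q‖ ≤ (1 + ε) * ‖p - q‖

/-- `ρ` is a vertex-restricted `ℓ`-simplification of `τ`: it has at most `ℓ` vertices, and its
vertex sequence is a subsequence of the vertex sequence of `τ` starting with the first vertex
of `τ` and ending with its last vertex. -/
def IsVRSimplification {d : ℕ} (ℓ : ℕ) (τ ρ : PolyCurve d) : Prop :=
  ρ.m ≤ ℓ ∧ ∃ g : Fin ρ.m → Fin τ.m, StrictMono g ∧
    (∀ i, ρ.vertex i = τ.vertex (g i)) ∧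
    g ⟨0, ρ.m_pos⟩ = ⟨0, τ.m_pos⟩ ∧
    g ⟨ρ.m - 1, Nat.sub_lt ρ.m_pos one_pos⟩ = ⟨τ.m - 1, Nat.sub_lt τ.m_pos one_pos⟩

/-- The optimal `(k,ℓ)`-median cost of a finite set `T` of polygonal curves: the infimum, over
all sets `C` of `k` polygonal curves each of complexity at most `ℓ`, of
`∑_{τ ∈ T} min_{c ∈ C} d_F(τ, c)`. -/
def kMedianCost {d : ℕ} (k ℓ : ℕ) (T : Finset (PolyCurve d)) : ℝ :=
  sInf { r | ∃ C : Finset (PolyCurve d), C.card = k ∧ (∀ c ∈ C, c.m ≤ ℓ) ∧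
    r = ∑ τ ∈ T, sInf ((fun c => frechetDist τ c) '' ↑C) }

section helpers

open MeasureTheory ProbabilityTheory

lemma gauss_sq_mgf (a : ℝ) (ha : a < 1/2) :
    ∫ y, Real.exp (a * y^2) ∂(gaussianReal 0 1) = (Real.sqrt (1 - 2*a))⁻¹ := by
  rw [integral_gaussianReal_eq_integral_smul (by simp)]
  have h : ∀ x : ℝ, gaussianPDFReal 0 1 x • Real.exp (a * x^2)
      = (Real.sqrt (2 * Real.pi))⁻¹ * Real.exp (-(1/2 - a) * x^2) := by
    intro x
    simp only [gaussianPDFReal, smul_eq_mul, mul_assoc, ← Real.exp_add]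
    congr 2
    · simp
    · simp; ring
  simp_rw [h]
  rw [integral_const_mul, integral_gaussian, ← Real.sqrt_inv, ← Real.sqrt_inv, ← Real.sqrt_mul]
  · congr 1
    have : 1 - 2 * a ≠ 0 := by linarith
    have h2 : 1/2 - a ≠ 0 := by linarith
    have := Real.pi_ne_zero
    field_simp
  · positivity

lemma proj_sq_mgf {d : ℕ} (x : EuclideanSpace ℝ (Fin d)) (hx : ‖x‖ = 1) (a : ℝ) (ha : a < 1/2) :
    ∫ g, Real.exp (a * ⟪x, g⟫^2) ∂(stdGaussian (EuclideanSpace ℝ (Fin d)))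
      = (Real.sqrt (1 - 2*a))⁻¹ := by
  have hm := IsGaussian.map_eq_gaussianReal (μ := stdGaussian (EuclideanSpace ℝ (Fin d)))
    (innerSL ℝ x)
  rw [integral_strongDual_stdGaussian, variance_dual_stdGaussian, innerSL_apply_norm, hx] at hm
  rw [← gauss_sq_mgf a ha]
  simp only [one_pow, Real.toNNReal_one] at hm
  rw [← hm, integral_map (by fun_prop) (by fun_prop)]
  simp

/-- product form -/
lemma prod_mgf {d : ℕ} (k : ℕ) (x : EuclideanSpace ℝ (Fin d)) (hx : ‖x‖ = 1) (a c : ℝ)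
    (ha : a < 1/2) :
    ∫ ω, Real.exp (a * ∑ i, ⟪x, ω i⟫^2 + c)
      ∂(Measure.pi (fun _ : Fin k => stdGaussian (EuclideanSpace ℝ (Fin d))))
      = (Real.sqrt (1 - 2*a))⁻¹ ^ k * Real.exp c := by
  simp_rw [Real.exp_add, Finset.mul_sum, Real.exp_sum]
  rw [integral_mul_const]
  congr 1
  rw [integral_fintype_prod_eq_pow (ι := Fin k)
    (fun g : EuclideanSpace ℝ (Fin d) => Real.exp (a * ⟪x, g⟫^2)), proj_sq_mgf x hx a ha]
  simp

lemma sqrt_bound (z b : ℝ) (hz : z < 1) (h : -Real.log (1 - z) ≤ 2 * b) :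
    (Real.sqrt (1 - z))⁻¹ ≤ Real.exp b := by
  have h1 : 0 < 1 - z := by linarith
  rw [← Real.log_le_iff_le_exp (by positivity), Real.log_inv, Real.log_sqrt h1.le]
  linarith

lemma both_bound (ε a : ℝ) (h0 : 0 < ε) (h1 : ε < 1) (ha : |a| = ε / 8) :
    (Real.sqrt (1 - 2 * a))⁻¹ ≤ Real.exp (a + ε^2/24) := by
  have hlt : |2 * a| = ε / 4 := by rw [abs_mul, ha]; norm_num; ring
  have hlt1 : |2 * a| < 1 := by rw [hlt]; linarith
  apply sqrt_bound _ _ (lt_of_le_of_lt (le_abs_self _) hlt1)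
  have h := Real.abs_log_sub_add_sum_range_le hlt1 1
  rw [hlt] at h
  simp only [Finset.range_one, Finset.sum_singleton] at h
  norm_num at h
  have h2 : (ε / 4) ^ 2 / (1 - ε / 4) ≤ ε ^ 2 / 12 := by
    rw [div_le_iff₀ (by linarith)]
    nlinarith [mul_pos h0 h0, mul_pos (mul_pos h0 h0) (sub_pos.2 h1)]
  have := neg_abs_le (2 * a + Real.log (1 - 2 * a))
  linarith

lemma term_bound {d : ℕ} (k : ℕ) (x : EuclideanSpace ℝ (Fin d)) (hx : ‖x‖ = 1) (ε a : ℝ)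
    (h0 : 0 < ε) (h1 : ε < 1) (ha : |a| = ε / 8) :
    Integrable (fun ω => Real.exp (a * ∑ i, ⟪x, ω i⟫^2 + (-a - ε^2/8) * k))
      (Measure.pi (fun _ : Fin k => stdGaussian (EuclideanSpace ℝ (Fin d)))) ∧
    ∫ ω, Real.exp (a * ∑ i, ⟪x, ω i⟫^2 + (-a - ε^2/8) * k)
      ∂(Measure.pi (fun _ : Fin k => stdGaussian (EuclideanSpace ℝ (Fin d))))
      ≤ Real.exp (- (k * ε^2 / 12)) := by
  have ha2 : a < 1/2 := by have := le_abs_self a; linarith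
  have key := prod_mgf k x hx a ((-a - ε^2/8) * k) ha2
  constructor
  · by_contra hc
    rw [integral_undef hc] at key
    have : 0 < (Real.sqrt (1 - 2*a))⁻¹ ^ k * Real.exp ((-a - ε^2/8) * k) := by
      have : 0 < 1 - 2 * a := by linarith
      positivity
    linarith
  · rw [key]
    calc _ ≤ (Real.exp (a + ε^2/24)) ^ k * Real.exp ((-a - ε^2/8) * k) := by
          gcongr
          exact both_bound ε a h0 h1 ha
      _ = _ := by
          rw [← Real.exp_nat_mul, ← Real.exp_add]
          congr 1
          ring

/-- Johnson-Lindenstrauss for unit vectors. -/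
lemma jl_unit {d : ℕ} (k : ℕ) (S : Finset (EuclideanSpace ℝ (Fin d))) (hS : ∀ x ∈ S, ‖x‖ = 1)
    (ε : ℝ) (h0 : 0 < ε) (h1 : ε < 1)
    (hk : 2 * (S.card : ℝ) * Real.exp (- (k * ε^2 / 12)) < 1) :
    ∃ ω : Fin k → EuclideanSpace ℝ (Fin d), ∀ x ∈ S,
      |∑ i, ⟪x, ω i⟫^2 - k| ≤ ε * k := by
  let G : EuclideanSpace ℝ (Fin d) → ℝ → (Fin k → EuclideanSpace ℝ (Fin d)) → ℝ :=
    fun x a ω => Real.exp (a * ∑ i, ⟪x, ω i⟫^2 + (-a - ε^2/8) * k)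
  have hp : |ε / 8| = ε / 8 := abs_of_pos (by positivity)
  have hn : |-(ε / 8)| = ε / 8 := by rw [abs_neg, hp]
  have hint : Integrable (fun ω => ∑ x ∈ S, (G x (ε/8) ω + G x (-(ε/8)) ω))
      (Measure.pi (fun _ : Fin k => stdGaussian (EuclideanSpace ℝ (Fin d)))) := by
    refine integrable_finsetSum _ fun x hx => ?_
    exact (term_bound k x (hS x hx) ε _ h0 h1 hp).1.add (term_bound k x (hS x hx) ε _ h0 h1 hn).1
  obtain ⟨ω, hω⟩ := exists_le_integral hint
  refine ⟨ω, ?_⟩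
  have hle : ∫ ω, ∑ x ∈ S, (G x (ε/8) ω + G x (-(ε/8)) ω)
      ∂(Measure.pi (fun _ : Fin k => stdGaussian (EuclideanSpace ℝ (Fin d)))) < 1 := by
    rw [integral_finsetSum]
    · refine lt_of_le_of_lt (Finset.sum_le_card_nsmul S _ (2 * Real.exp (- (k * ε^2 / 12))) ?_) ?_
      · intro x hx
        have A := term_bound k x (hS x hx) ε _ h0 h1 hp
        have B := term_bound k x (hS x hx) ε _ h0 h1 hn
        rw [integral_add A.1 B.1]
        linarith [A.2, B.2]
      · rw [nsmul_eq_mul]; linarith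
    · intro x hx
      exact (term_bound k x (hS x hx) ε _ h0 h1 hp).1.add (term_bound k x (hS x hx) ε _ h0 h1 hn).1
  intro x hx
  have hx1 : G x (ε/8) ω + G x (-(ε/8)) ω < 1 := by
    refine lt_of_le_of_lt ?_ (hω.trans_lt hle)
    exact Finset.single_le_sum (f := fun x => G x (ε/8) ω + G x (-(ε/8)) ω)
      (fun y _ => by positivity) hx
  have hA : G x (ε/8) ω < 1 := by
    have : 0 < G x (-(ε/8)) ω := Real.exp_pos _
    linarith
  have hB : G x (-(ε/8)) ω < 1 := by
    have : 0 < G x (ε/8) ω := Real.exp_pos _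
    linarith
  simp only [G, Real.exp_lt_one_iff] at hA hB
  rw [abs_le]
  constructor
  · by_contra hc
    push Not at hc
    nlinarith
  · by_contra hc
    push Not at hc
    nlinarith

/-- Johnson-Lindenstrauss, squared form. -/
lemma jl_sq {d : ℕ} (k : ℕ) (S : Finset (EuclideanSpace ℝ (Fin d)))
    (ε : ℝ) (h0 : 0 < ε) (h1 : ε < 1)
    (hk : 2 * (S.card : ℝ) * Real.exp (- (k * ε^2 / 12)) < 1) (hk0 : 0 < k) :
    ∃ f : EuclideanSpace ℝ (Fin d) →ₗ[ℝ] EuclideanSpace ℝ (Fin k), ∀ x ∈ S,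
      |‖f x‖^2 - ‖x‖^2| ≤ ε * ‖x‖^2 := by
  let S' : Finset (EuclideanSpace ℝ (Fin d)) :=
    (S.filter (fun x => x ≠ 0)).image (fun x => (‖x‖⁻¹ : ℝ) • x)
  have hS1 : ∀ x ∈ S', ‖x‖ = 1 := by
    intro y hy
    obtain ⟨x, hx, rfl⟩ := Finset.mem_image.1 hy
    exact norm_smul_inv_norm (𝕜 := ℝ) (Finset.mem_filter.1 hx).2
  have hcard : S'.card ≤ S.card :=
    le_trans Finset.card_image_le (Finset.card_filter_le S (fun x => x ≠ 0))
  have hcard' : (S'.card : ℝ) ≤ S.card := by exact_mod_cast hcard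
  obtain ⟨ω, hω⟩ := jl_unit k S' hS1 ε h0 h1 (lt_of_le_of_lt (by gcongr) hk)
  let f : EuclideanSpace ℝ (Fin d) →ₗ[ℝ] EuclideanSpace ℝ (Fin k) :=
    { toFun := fun x => WithLp.toLp 2 (fun i => (Real.sqrt k)⁻¹ * ⟪x, ω i⟫)
      map_add' := by
        intro x y; ext i; simp [inner_add_left, mul_add]
      map_smul' := by
        intro c x; ext i; simp [inner_smul_left]; ring }
  have hf : ∀ x, ‖f x‖^2 = (k:ℝ)⁻¹ * ∑ i, ⟪x, ω i⟫^2 := by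
    intro x
    rw [EuclideanSpace.norm_sq_eq, Finset.mul_sum]
    refine Finset.sum_congr rfl fun i _ => ?_
    simp only [f, LinearMap.coe_mk, AddHom.coe_mk, Real.norm_eq_abs, sq_abs, mul_pow, inv_pow]
    rw [Real.sq_sqrt (by positivity)]
  refine ⟨f, fun x hx => ?_⟩
  by_cases hx0 : x = 0
  · simp [hx0]
  have h := hω _ (Finset.mem_image_of_mem _ (Finset.mem_filter.2 ⟨hx, hx0⟩))
  have hn : 0 < ‖x‖ := norm_pos_iff.2 hx0
  have hkr : (0:ℝ) < k := by exact_mod_cast hk0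
  simp only [inner_smul_left, mul_pow, ← Finset.mul_sum] at h
  have e1 : ∑ i, ⟪x, ω i⟫^2 = k * ‖f x‖^2 := by rw [hf]; field_simp
  rw [e1] at h
  have e2 : ‖f x‖^2 - ‖x‖^2 = (‖x‖^2/k) * ((starRingEnd ℝ) ‖x‖⁻¹ ^ 2 * (k * ‖f x‖^2) - k) := by
    simp only [conj_trivial]
    field_simp
  rw [e2, abs_mul, abs_of_pos (by positivity)]
  calc _ ≤ ‖x‖^2/k * (ε * k) := by gcongr
    _ = _ := by field_simp

lemma polar_bound {d k n : ℕ} (f : EuclideanSpace ℝ (Fin d) →ₗ[ℝ] EuclideanSpace ℝ (Fin k))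
    (u : Fin n → EuclideanSpace ℝ (Fin d)) (hu : Orthonormal ℝ u) (ε : ℝ) (h0 : 0 < ε)
    (hf : ∀ i j, |‖f (u i + u j)‖^2 - ‖u i + u j‖^2| ≤ ε * ‖u i + u j‖^2) (c : Fin n → ℝ) :
    |‖f (∑ i, c i • u i)‖^2 - ‖∑ i, c i • u i‖^2| ≤ 3 * ε * n * ‖∑ i, c i • u i‖^2 := by
  have hn : ∀ i j, ‖u i + u j‖^2 ≤ 4 := by
    intro i j
    have := norm_add_le (u i) (u j)
    rw [hu.1 i, hu.1 j] at this
    nlinarith [norm_nonneg (u i + u j)]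
  have hd : ∀ i, |‖f (u i)‖^2 - ‖u i‖^2| ≤ ε := by
    intro i
    have h := hf i i
    rw [← two_smul ℝ (u i), map_smul, norm_smul, norm_smul, hu.1 i] at h
    rw [hu.1 i]
    norm_num at h
    rw [abs_le] at h ⊢
    constructor <;> nlinarith [h.1, h.2]
  have hD : ∀ i j, |⟪f (u i), f (u j)⟫ - ⟪u i, u j⟫| ≤ 3 * ε := by
    intro i j
    have e1 := norm_add_sq_real (f (u i)) (f (u j))
    have e2 := norm_add_sq_real (u i) (u j)
    rw [← map_add] at e1
    have h1 := hf i j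
    have h2 : ε * ‖u i + u j‖^2 ≤ ε * 4 := by gcongr; exact hn i j
    have h3 := hd i
    have h4 := hd j
    rw [abs_le] at h1 h3 h4 ⊢
    constructor <;> linarith [h1.1, h1.2, h3.1, h3.2, h4.1, h4.2]
  have hx : ‖∑ i, c i • u i‖^2 = ∑ i, c i ^ 2 := by
    rw [← real_inner_self_eq_norm_sq, hu.inner_sum]
    simp [sq]
  have hdiff : ‖f (∑ i, c i • u i)‖^2 - ‖∑ i, c i • u i‖^2
      = ∑ i, ∑ j, c i * c j * (⟪f (u i), f (u j)⟫ - ⟪u i, u j⟫) := by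
    rw [← real_inner_self_eq_norm_sq, ← real_inner_self_eq_norm_sq, map_sum]
    simp only [sum_inner, inner_sum, map_smul, inner_smul_left, inner_smul_right,
      ← Finset.sum_sub_distrib, conj_trivial]
    refine Finset.sum_congr rfl fun i _ => ?_
    rw [← mul_sub, ← Finset.sum_sub_distrib, Finset.mul_sum]
    refine Finset.sum_congr rfl fun j _ => ?_
    rw [real_inner_comm (f (u i)), real_inner_comm (u i)]
    ring
  rw [hdiff, hx]
  calc _ ≤ ∑ i, ∑ j, |c i| * |c j| * (3 * ε) := by
        refine (Finset.abs_sum_le_sum_abs _ _).trans (Finset.sum_le_sum fun i _ => ?_)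
        refine (Finset.abs_sum_le_sum_abs _ _).trans (Finset.sum_le_sum fun j _ => ?_)
        rw [abs_mul, abs_mul]
        gcongr
        exact hD i j
    _ = 3 * ε * (∑ i, |c i|)^2 := by
        rw [sq, Finset.sum_mul_sum, Finset.mul_sum]
        refine Finset.sum_congr rfl fun i _ => ?_
        rw [Finset.mul_sum]
        refine Finset.sum_congr rfl fun j _ => ?_
        ring
    _ ≤ 3 * ε * (n * ∑ i, |c i|^2) := by
        gcongr
        simpa using sq_sum_le_card_mul_sum_sq (s := (Finset.univ : Finset (Fin n)))
          (f := fun i => |c i|)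
    _ = _ := by simp only [sq_abs]; ring

lemma sub_embed {d : ℕ} (M k : ℕ) (W : Finset (Submodule ℝ (EuclideanSpace ℝ (Fin d))))
    (hW : ∀ V ∈ W, Module.finrank ℝ V ≤ 4) (hc : W.card ≤ M * M) (hM : 2 ≤ M)
    (ε : ℝ) (h0 : 0 < ε) (h1 : ε < 1) (hk : 20000 * ε⁻¹^2 * Real.log M ≤ k) :
    ∃ f : EuclideanSpace ℝ (Fin d) →ₗ[ℝ] EuclideanSpace ℝ (Fin k), ∀ V ∈ W, ∀ x ∈ V,
      |‖f x‖^2 - ‖x‖^2| ≤ ε * ‖x‖^2 := by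
  let b := fun V : Submodule ℝ (EuclideanSpace ℝ (Fin d)) => stdOrthonormalBasis ℝ V
  let S := W.biUnion fun V => (Finset.univ : Finset (Fin (Module.finrank ℝ V) ×
    Fin (Module.finrank ℝ V))).image fun p => (b V p.1 : EuclideanSpace ℝ (Fin d)) + b V p.2
  have hM' : (2:ℝ) ≤ M := by exact_mod_cast hM
  have hlog : 0 < Real.log M := Real.log_pos (by linarith)
  have hk0 : (0:ℝ) < k := lt_of_lt_of_le (by positivity) hk
  have hS : S.card ≤ M * M * 16 := by
    refine (Finset.card_biUnion_le_card_mul _ _ 16 ?_).trans (Nat.mul_le_mul_right _ hc)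
    intro V hV
    refine Finset.card_image_le.trans ?_
    rw [Finset.card_univ, Fintype.card_prod, Fintype.card_fin]
    have := hW V hV
    nlinarith
  have hS' : (S.card : ℝ) ≤ M * M * 16 := by exact_mod_cast hS
  have hexp : Real.exp (-(k * (ε/12)^2/12)) ≤ ((M:ℝ)^8)⁻¹ := by
    rw [← Real.exp_log (show (0:ℝ) < M^8 by positivity), ← Real.exp_neg, Real.exp_le_exp,
      Real.log_pow]
    have : 20000 * Real.log M ≤ k * ε^2 := by
      calc _ = 20000 * ε⁻¹^2 * Real.log M * ε^2 := by field_simp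
        _ ≤ _ := by gcongr
    push_cast
    nlinarith
  obtain ⟨f, hf⟩ := jl_sq k S (ε/12) (by linarith) (by linarith) (by
    calc _ ≤ 2 * (M * M * 16 : ℝ) * ((M:ℝ)^8)⁻¹ := by gcongr
      _ = 32 / M^6 := by field_simp; norm_num
      _ < 1 := by
        rw [div_lt_one (by positivity)]
        calc (32:ℝ) < 2^6 := by norm_num
          _ ≤ _ := by gcongr) (by exact_mod_cast hk0)
  refine ⟨f, fun V hV x hx => ?_⟩
  have hu : Orthonormal ℝ (fun i => (b V i : EuclideanSpace ℝ (Fin d))) :=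
    (b V).orthonormal.comp_linearIsometry V.subtypeₗᵢ
  have hx' : x = ∑ i, (b V).repr ⟨x, hx⟩ i • (b V i : EuclideanSpace ℝ (Fin d)) := by
    have := congrArg (Subtype.val) ((b V).sum_repr ⟨x, hx⟩)
    simpa using this.symm
  have hp := polar_bound f _ hu (ε/12) (by linarith) (fun i j => hf _ (by
    refine Finset.mem_biUnion.2 ⟨V, hV, Finset.mem_image.2 ⟨(i, j), Finset.mem_univ _, rfl⟩⟩))
    ((b V).repr ⟨x, hx⟩)
  rw [← hx'] at hp
  refine hp.trans ?_
  have : (Module.finrank ℝ V : ℝ) ≤ 4 := by exact_mod_cast hW V hV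
  gcongr
  nlinarith

end helpers

lemma PolyCurve.two_le {d : ℕ} (τ : PolyCurve d) : 2 ≤ τ.m := by
  by_contra h
  have h1 := τ.m_pos
  have h2 : τ.m - 1 = 0 := by omega
  have h3 := τ.instant_first
  have h4 := τ.instant_last
  have : (⟨τ.m - 1, Nat.sub_lt τ.m_pos one_pos⟩ : Fin τ.m) = ⟨0, τ.m_pos⟩ := Fin.ext h2
  rw [this, h3] at h4
  exact zero_ne_one h4

lemma PolyCurve.between {d : ℕ} (τ : PolyCurve d) (i j : Fin τ.m) (hij : (j : ℕ) = i + 1) (t : ℝ)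
    (h1 : τ.instant i ≤ t) (h2 : t ≤ τ.instant j) :
    ∃ s ∈ Set.Icc (0:ℝ) 1, τ.toFun t = (1 - s) • τ.vertex i + s • τ.vertex j := by
  have hlt : τ.instant i < τ.instant j := τ.instant_strictMono (by rw [Fin.lt_def]; omega)
  have hpos : 0 < τ.instant j - τ.instant i := by linarith
  have hs : (t - τ.instant i) / (τ.instant j - τ.instant i) ∈ Set.Icc (0:ℝ) 1 :=
    ⟨div_nonneg (by linarith) hpos.le, (div_le_one hpos).2 (by linarith)⟩
  refine ⟨_, hs, ?_⟩
  rw [← τ.affine_on_segments i j hij _ hs]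
  congr 1
  field_simp
  ring

lemma PolyCurve.exists_edge {d : ℕ} (τ : PolyCurve d) (t : ℝ) (ht : t ∈ Set.Icc (0:ℝ) 1) :
    ∃ i j : Fin τ.m, (j : ℕ) = i + 1 ∧
    ∃ s ∈ Set.Icc (0:ℝ) 1, τ.toFun t = (1 - s) • τ.vertex i + s • τ.vertex j := by
  have key : ∀ n : ℕ, ∀ h : n + 1 < τ.m, t ≤ τ.instant ⟨n + 1, h⟩ →
      ∃ i j : Fin τ.m, (j : ℕ) = i + 1 ∧
      ∃ s ∈ Set.Icc (0:ℝ) 1, τ.toFun t = (1 - s) • τ.vertex i + s • τ.vertex j := by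
    intro n
    induction n with
    | zero =>
      intro h hle
      refine ⟨⟨0, τ.m_pos⟩, ⟨0 + 1, h⟩, rfl, τ.between _ _ rfl t ?_ hle⟩
      rw [τ.instant_first]; exact ht.1
    | succ n ih =>
      intro h hle
      by_cases hc : t ≤ τ.instant ⟨n + 1, by omega⟩
      · exact ih (by omega) hc
      · exact ⟨⟨n + 1, by omega⟩, ⟨n + 1 + 1, h⟩, rfl,
          τ.between _ _ rfl t (le_of_lt (not_le.1 hc)) hle⟩
  have h2 := τ.two_le
  refine key (τ.m - 2) (by omega) ?_
  have : (⟨τ.m - 2 + 1, by omega⟩ : Fin τ.m) = ⟨τ.m - 1, Nat.sub_lt τ.m_pos one_pos⟩ := by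
    apply Fin.ext; simp only []; omega
  rw [this, τ.instant_last]
  exact ht.2

lemma PolyCurve.norm_bound {d : ℕ} (τ : PolyCurve d) :
    ∃ B : ℝ, ∀ t ∈ Set.Icc (0:ℝ) 1, ‖τ.toFun t‖ ≤ B := by
  refine ⟨∑ i, ‖τ.vertex i‖, fun t ht => ?_⟩
  obtain ⟨i, j, -, s, hs, e⟩ := τ.exists_edge t ht
  have hi := Finset.single_le_sum (f := fun i => ‖τ.vertex i‖) (fun i _ => norm_nonneg _)
    (Finset.mem_univ i)
  have hj := Finset.single_le_sum (f := fun i => ‖τ.vertex i‖) (fun i _ => norm_nonneg _)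
    (Finset.mem_univ j)
  rw [e]
  refine (norm_add_le _ _).trans ?_
  rw [norm_smul, norm_smul, Real.norm_of_nonneg hs.1, Real.norm_of_nonneg (by linarith [hs.2])]
  nlinarith [hs.1, hs.2]

/-- Edges of a curve, as pairs of consecutive vertices. -/
def PolyCurve.edges {d : ℕ} (τ : PolyCurve d) :
    Finset (EuclideanSpace ℝ (Fin d) × EuclideanSpace ℝ (Fin d)) :=
  Finset.univ.image fun i : Fin τ.m =>
    (τ.vertex i, if h : (i : ℕ) + 1 < τ.m then τ.vertex ⟨i + 1, h⟩ else τ.vertex i)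

lemma PolyCurve.card_edges {d : ℕ} (τ : PolyCurve d) : τ.edges.card ≤ τ.m := by
  refine Finset.card_image_le.trans ?_
  simp

lemma PolyCurve.exists_edge' {d : ℕ} (τ : PolyCurve d) (t : ℝ) (ht : t ∈ Set.Icc (0:ℝ) 1) :
    ∃ e ∈ τ.edges, ∃ s : ℝ, τ.toFun t = (1 - s) • e.1 + s • e.2 := by
  obtain ⟨i, j, hij, s, hs, e⟩ := τ.exists_edge t ht
  refine ⟨(τ.vertex i, τ.vertex j), Finset.mem_image.2 ⟨i, Finset.mem_univ _, ?_⟩, s, e⟩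
  have hj : (i : ℕ) + 1 < τ.m := by rw [← hij]; exact j.2
  rw [dif_pos hj]
  congr 2
  exact Fin.ext hij.symm

/-- The span of a pair of edges. -/
def edgeSpan {d : ℕ} (p : (EuclideanSpace ℝ (Fin d) × EuclideanSpace ℝ (Fin d)) ×
    (EuclideanSpace ℝ (Fin d) × EuclideanSpace ℝ (Fin d))) :
    Submodule ℝ (EuclideanSpace ℝ (Fin d)) :=
  Submodule.span ℝ (Set.range ![p.1.1, p.1.2, p.2.1, p.2.2])

lemma edgeSpan_finrank {d : ℕ} (p : (EuclideanSpace ℝ (Fin d) × EuclideanSpace ℝ (Fin d)) ×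
    (EuclideanSpace ℝ (Fin d) × EuclideanSpace ℝ (Fin d))) :
    Module.finrank ℝ (edgeSpan p) ≤ 4 := by
  have := finrank_range_le_card (R := ℝ) ![p.1.1, p.1.2, p.2.1, p.2.2]
  rw [Fintype.card_fin] at this
  exact this

lemma edgeSpan_mem {d : ℕ} (e e' : EuclideanSpace ℝ (Fin d) × EuclideanSpace ℝ (Fin d))
    (s t : ℝ) : ((1 - s) • e.1 + s • e.2) - ((1 - t) • e'.1 + t • e'.2) ∈ edgeSpan (e, e') := by
  have h : ∀ i, ![e.1, e.2, e'.1, e'.2] i ∈ edgeSpan (e, e') :=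
    fun i => Submodule.subset_span ⟨i, rfl⟩
  exact Submodule.sub_mem _
    (Submodule.add_mem _ (Submodule.smul_mem _ _ (h 0)) (Submodule.smul_mem _ _ (h 1)))
    (Submodule.add_mem _ (Submodule.smul_mem _ _ (h 2)) (Submodule.smul_mem _ _ (h 3)))

lemma norm_of_sq (ε a b : ℝ) (h0 : 0 < ε) (h1 : ε < 1) (ha : 0 ≤ a) (hb : 0 ≤ b)
    (h : |b^2 - a^2| ≤ ε * a^2) : (1 - ε) * a ≤ b ∧ b ≤ (1 + ε) * a := by
  rw [abs_le] at h
  constructor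
  · refine le_of_sq_le_sq ?_ hb
    nlinarith [h.1, sq_nonneg a, mul_nonneg (mul_nonneg h0.le (sub_pos.2 h1).le) (sq_nonneg a)]
  · refine le_of_sq_le_sq ?_ (by positivity)
    nlinarith [h.2, sq_nonneg a, mul_nonneg h0.le (sq_nonneg a), sq_nonneg (ε * a)]

lemma isReparam_id : IsReparam id :=
  ⟨⟨continuousOn_id, fun _ h => h, rfl, rfl⟩, Set.bijOn_id _⟩

/-- Comparison of a Fréchet-type distance over an arbitrary class of reparameterizations. -/
lemma compare_gen {d d' : ℕ} (σ τ : PolyCurve d)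
    (f : EuclideanSpace ℝ (Fin d) →ₗ[ℝ] EuclideanSpace ℝ (Fin d')) (ε : ℝ) (h0 : 0 < ε) (h1 : ε < 1)
    (hf : ∀ s ∈ Set.Icc (0:ℝ) 1, ∀ t ∈ Set.Icc (0:ℝ) 1,
      (1 - ε) * ‖σ.toFun s - τ.toFun t‖ ≤ ‖f (σ.toFun s) - f (τ.toFun t)‖ ∧
      ‖f (σ.toFun s) - f (τ.toFun t)‖ ≤ (1 + ε) * ‖σ.toFun s - τ.toFun t‖)
    (P : (ℝ → ℝ) → Prop) (hid : P id) (hP : ∀ φ, P φ → Set.MapsTo φ (Set.Icc 0 1) (Set.Icc 0 1)) :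
    |sInf { r | ∃ φ ψ : ℝ → ℝ, P φ ∧ P ψ ∧
      r = ⨆ t : Set.Icc (0:ℝ) 1, ‖σ.toFun (φ t.1) - τ.toFun (ψ t.1)‖ } -
     sInf { r | ∃ φ ψ : ℝ → ℝ, P φ ∧ P ψ ∧
      r = ⨆ t : Set.Icc (0:ℝ) 1, ‖(σ.map f).toFun (φ t.1) - (τ.map f).toFun (ψ t.1)‖ }|
    ≤ ε * sInf { r | ∃ φ ψ : ℝ → ℝ, P φ ∧ P ψ ∧
      r = ⨆ t : Set.Icc (0:ℝ) 1, ‖σ.toFun (φ t.1) - τ.toFun (ψ t.1)‖ } := by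
  obtain ⟨A, hA⟩ := σ.norm_bound
  obtain ⟨B, hB⟩ := τ.norm_bound
  have bd : ∀ φ ψ, P φ → P ψ → BddAbove (Set.range fun t : Set.Icc (0:ℝ) 1 =>
      ‖σ.toFun (φ t.1) - τ.toFun (ψ t.1)‖) := by
    rintro φ ψ hφ hψ
    refine ⟨A + B, ?_⟩
    rintro _ ⟨t, rfl⟩
    exact (norm_sub_le _ _).trans (add_le_add (hA _ (hP φ hφ t.2)) (hB _ (hP ψ hψ t.2)))
  have bd' : ∀ φ ψ, P φ → P ψ → BddAbove (Set.range fun t : Set.Icc (0:ℝ) 1 =>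
      ‖(σ.map f).toFun (φ t.1) - (τ.map f).toFun (ψ t.1)‖) := by
    rintro φ ψ hφ hψ
    obtain ⟨K, hK⟩ := bd φ ψ hφ hψ
    refine ⟨(1 + ε) * K, ?_⟩
    rintro _ ⟨t, rfl⟩
    refine (hf _ (hP φ hφ t.2) _ (hP ψ hψ t.2)).2.trans ?_
    have := hK ⟨t, rfl⟩
    gcongr
  have : Nonempty (Set.Icc (0:ℝ) 1) := ⟨⟨0, by simp⟩⟩
  have lo : ∀ φ ψ, P φ → P ψ → (1 - ε) * (⨆ t : Set.Icc (0:ℝ) 1,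
      ‖σ.toFun (φ t.1) - τ.toFun (ψ t.1)‖) ≤
      ⨆ t : Set.Icc (0:ℝ) 1, ‖(σ.map f).toFun (φ t.1) - (τ.map f).toFun (ψ t.1)‖ := by
    intro φ ψ hφ hψ
    rw [Real.mul_iSup_of_nonneg (by linarith)]
    exact ciSup_le fun t => (hf _ (hP φ hφ t.2) _ (hP ψ hψ t.2)).1.trans
      (le_ciSup (bd' φ ψ hφ hψ) t)
  have hi : ∀ φ ψ, P φ → P ψ →
      (⨆ t : Set.Icc (0:ℝ) 1, ‖(σ.map f).toFun (φ t.1) - (τ.map f).toFun (ψ t.1)‖) ≤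
      (1 + ε) * (⨆ t : Set.Icc (0:ℝ) 1, ‖σ.toFun (φ t.1) - τ.toFun (ψ t.1)‖) := by
    intro φ ψ hφ hψ
    refine ciSup_le fun t => (hf _ (hP φ hφ t.2) _ (hP ψ hψ t.2)).2.trans ?_
    gcongr
    exact le_ciSup (bd φ ψ hφ hψ) t
  set X := { r | ∃ φ ψ : ℝ → ℝ, P φ ∧ P ψ ∧
      r = ⨆ t : Set.Icc (0:ℝ) 1, ‖σ.toFun (φ t.1) - τ.toFun (ψ t.1)‖ } with hX
  set Y := { r | ∃ φ ψ : ℝ → ℝ, P φ ∧ P ψ ∧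
      r = ⨆ t : Set.Icc (0:ℝ) 1, ‖(σ.map f).toFun (φ t.1) - (τ.map f).toFun (ψ t.1)‖ } with hY
  have X0 : X.Nonempty := ⟨_, id, id, hid, hid, rfl⟩
  have Y0 : Y.Nonempty := ⟨_, id, id, hid, hid, rfl⟩
  have Xb : BddBelow X := by
    refine ⟨0, ?_⟩
    rintro _ ⟨φ, ψ, -, -, rfl⟩
    exact Real.iSup_nonneg fun t => norm_nonneg _
  have Yb : BddBelow Y := by
    refine ⟨0, ?_⟩
    rintro _ ⟨φ, ψ, -, -, rfl⟩
    exact Real.iSup_nonneg fun t => norm_nonneg _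
  have L : (1 - ε) * sInf X ≤ sInf Y := by
    refine le_csInf Y0 ?_
    rintro _ ⟨φ, ψ, hφ, hψ, rfl⟩
    refine le_trans ?_ (lo φ ψ hφ hψ)
    exact mul_le_mul_of_nonneg_left (csInf_le Xb ⟨φ, ψ, hφ, hψ, rfl⟩) (by linarith)
  have U : sInf Y ≤ (1 + ε) * sInf X := by
    rw [← div_le_iff₀' (by linarith)]
    refine le_csInf X0 ?_
    rintro _ ⟨φ, ψ, hφ, hψ, rfl⟩
    rw [div_le_iff₀' (by linarith)]
    exact (csInf_le Yb ⟨φ, ψ, hφ, hψ, rfl⟩).trans (hi φ ψ hφ hψ)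
  rw [abs_le]
  constructor <;> linarith

/-- dimension reduction to O(ε⁻² log(nm)) dimensions preserving all pairwise
(weak) Fréchet distances within a factor (1±ε). -/
theorem statement6 : ∃ C : ℝ, 0 < C ∧
    ∀ (d n m : ℕ) (T : Finset (PolyCurve d)), T.card = n → (∀ τ ∈ T, τ.m ≤ m) →
      2 ≤ n * m → ∀ ε : ℝ, ε ∈ Set.Ioo (0:ℝ) 1 →
      ∃ (d' : ℕ) (f : EuclideanSpace ℝ (Fin d) →ₗ[ℝ] EuclideanSpace ℝ (Fin d')),
        d' ≤ ⌈C * ε⁻¹ ^ 2 * Real.log ((n : ℝ) * (m : ℝ))⌉₊ ∧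
        ∀ σ ∈ T, ∀ τ ∈ T,
          |frechetDist σ τ - frechetDist (σ.map f) (τ.map f)| ≤ ε * frechetDist σ τ ∧
          |weakFrechetDist σ τ - weakFrechetDist (σ.map f) (τ.map f)| ≤
            ε * weakFrechetDist σ τ := by
  refine ⟨20000, by norm_num, ?_⟩
  intro d n m T hn hm hnm ε hε
  obtain ⟨h0, h1⟩ := hε
  let E := T.biUnion PolyCurve.edges
  have hE : E.card ≤ n * m := by
    rw [← hn]
    exact Finset.card_biUnion_le_card_mul _ _ _ fun τ hτ => τ.card_edges.trans (hm τ hτ)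
  let W := (E ×ˢ E).image edgeSpan
  have hW : W.card ≤ (n * m) * (n * m) := by
    refine Finset.card_image_le.trans ?_
    rw [Finset.card_product]
    exact Nat.mul_le_mul hE hE
  obtain ⟨f, hf⟩ := sub_embed (n * m)
    ⌈20000 * ε⁻¹ ^ 2 * Real.log ((n : ℝ) * (m : ℝ))⌉₊ W (by
      intro V hV
      obtain ⟨p, -, rfl⟩ := Finset.mem_image.1 hV
      exact edgeSpan_finrank p) hW hnm ε h0 h1 (by
      push_cast
      exact Nat.le_ceil _)
  refine ⟨_, f, le_rfl, fun σ hσ τ hτ => ?_⟩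
  have key : ∀ s ∈ Set.Icc (0:ℝ) 1, ∀ t ∈ Set.Icc (0:ℝ) 1,
      (1 - ε) * ‖σ.toFun s - τ.toFun t‖ ≤ ‖f (σ.toFun s) - f (τ.toFun t)‖ ∧
      ‖f (σ.toFun s) - f (τ.toFun t)‖ ≤ (1 + ε) * ‖σ.toFun s - τ.toFun t‖ := by
    intro s hs t ht
    obtain ⟨e, he, a, ea⟩ := σ.exists_edge' s hs
    obtain ⟨e', he', b, eb⟩ := τ.exists_edge' t ht
    rw [← map_sub]
    refine norm_of_sq ε _ _ h0 h1 (norm_nonneg _) (norm_nonneg _) ?_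
    refine hf (edgeSpan (e, e')) ?_ _ ?_
    · exact Finset.mem_image_of_mem _ (Finset.mk_mem_product
        (Finset.mem_biUnion.2 ⟨σ, hσ, he⟩) (Finset.mem_biUnion.2 ⟨τ, hτ, he'⟩))
    · rw [ea, eb]
      exact edgeSpan_mem e e' a b
  exact ⟨compare_gen σ τ f ε h0 h1 key IsReparam isReparam_id (fun φ h => h.1.2.1),
    compare_gen σ τ f ε h0 h1 key IsWeakReparam isReparam_id.1 (fun φ h => h.2.1)⟩

end
end

section
/- There is an absolute constant C > 0 such that the following holds. Let T = {τ_1,…,τ_n} be a set of n polygonal curves in ℝ^d, each of complexity at most m, let k ∈ ℕ, let ℓ ≥ m with n·ℓ ≥ 2, and let ε ∈ (0,1). Assume there exists a set C* of k polygonal curves in ℝ^d, each of complexity at most ℓ, attaining the optimal (k,ℓ)-median cost r* of T. Then there exists a linear map f : ℝ^d → ℝ^{d′} with d′ ≤ ⌈C·ε^{−2}·log(nℓ)⌉ such that ((1−ε)/2)·r* ≤ r_f* ≤ (1+ε)·r*, where r_f* is the optimal (k,ℓ)-median cost of F(T) = {F(τ) : τ ∈ T}. -/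
open scoped Classical RealInnerProductSpace

noncomputable section

section JL
open MeasureTheory ProbabilityTheory

lemma gauss_integrable (a : ℝ) (ha : a < 1/2) :
    Integrable (fun x : ℝ => Real.exp (a * x^2)) (gaussianReal 0 1) := by
  rw [gaussianReal_of_var_ne_zero _ one_ne_zero, integrable_withDensity_iff_integrable_smul']
  · have := (integrable_exp_neg_mul_sq (b := 1/2 - a) (by linarith)).const_mul ((√(2 * Real.pi))⁻¹)
    refine this.congr (Filter.Eventually.of_forall fun x => ?_)
    simp only [toReal_gaussianPDF, gaussianPDFReal, smul_eq_mul, NNReal.coe_one, mul_one, sub_zero]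
    rw [mul_assoc, ← Real.exp_add]
    ring_nf
  · fun_prop
  · exact Filter.Eventually.of_forall fun x => gaussianPDF_lt_top

lemma gauss_integral (a : ℝ) (ha : a < 1/2) :
    ∫ x : ℝ, Real.exp (a * x^2) ∂(gaussianReal 0 1) = (√(1 - 2 * a))⁻¹ := by
  rw [integral_gaussianReal_eq_integral_smul one_ne_zero]
  have : ∀ x : ℝ, gaussianPDFReal 0 1 x • Real.exp (a * x^2)
      = (√(2 * Real.pi))⁻¹ * Real.exp (-(1/2 - a) * x^2) := by
    intro x
    simp only [gaussianPDFReal, smul_eq_mul, NNReal.coe_one, mul_one, sub_zero]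
    rw [mul_assoc, ← Real.exp_add]
    ring_nf
  simp_rw [this]
  rw [integral_const_mul, integral_gaussian, ← Real.sqrt_inv, ← Real.sqrt_inv, ← Real.sqrt_mul (by positivity)]
  congr 1
  have := Real.pi_pos
  have : 1 - 2 * a ≠ 0 := by linarith
  have : 1/2 - a ≠ 0 := by intro h; linarith
  field_simp

lemma map_inner_gauss {d : ℕ} (u : EuclideanSpace ℝ (Fin d)) (hu : ‖u‖ = 1) :
    (stdGaussian (EuclideanSpace ℝ (Fin d))).map (fun g => ⟪u, g⟫) = gaussianReal 0 1 := by
  have h := IsGaussian.map_eq_gaussianReal (μ := stdGaussian (EuclideanSpace ℝ (Fin d))) (innerSL ℝ u)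
  rw [integral_strongDual_stdGaussian, variance_dual_stdGaussian] at h
  simp only [innerSL_apply_norm, hu] at h
  simpa using h

lemma std_integrable {d : ℕ} (u : EuclideanSpace ℝ (Fin d)) (hu : ‖u‖ = 1) (a : ℝ) (ha : a < 1/2) :
    Integrable (fun g => Real.exp (a * ⟪u, g⟫^2)) (stdGaussian (EuclideanSpace ℝ (Fin d))) := by
  have h := gauss_integrable a ha
  rw [← map_inner_gauss u hu] at h
  exact h.comp_measurable (by fun_prop)

lemma std_integral {d : ℕ} (u : EuclideanSpace ℝ (Fin d)) (hu : ‖u‖ = 1) (a : ℝ) (ha : a < 1/2) :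
    ∫ g, Real.exp (a * ⟪u, g⟫^2) ∂(stdGaussian (EuclideanSpace ℝ (Fin d))) = (√(1 - 2 * a))⁻¹ := by
  rw [← gauss_integral a ha, ← map_inner_gauss u hu, integral_map (by fun_prop) (by fun_prop)]

/-- scalar bound on the moment generating function -/
lemma mgf_bound (a : ℝ) (ha : |a| ≤ 1/4) : (√(1 - 2 * a))⁻¹ ≤ Real.exp (a + 4 * a^2) := by
  have ha' := abs_le.1 ha
  have h1 : 0 < 1 - 2 * a := by linarith
  have habs : |2 * a| ≤ 1/2 := by rw [abs_mul]; norm_num; linarith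
  have h := Real.abs_log_sub_add_sum_range_le (x := 2 * a) (by linarith) 1
  simp only [Finset.sum_range_one, Nat.cast_zero, zero_add, pow_one, div_one] at h
  have h2 : |2 * a| ^ (1+1) / (1 - |2 * a|) ≤ 8 * a^2 := by
    rw [div_le_iff₀ (by linarith)]
    have : |2*a|^(1+1) = 4 * a^2 := by
      rw [show (1+1) = 2 from rfl, sq_abs]; ring
    rw [this]
    nlinarith [sq_nonneg a]
  have h3 := (abs_le.1 (h.trans h2)).1
  rw [inv_le_comm₀ (by positivity) (by positivity), ← Real.exp_neg]
  apply Real.le_sqrt_of_sq_le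
  rw [← Real.exp_nat_mul, ← Real.le_log_iff_exp_le h1]
  push_cast
  linarith

lemma row_integral {d D : ℕ} (u : EuclideanSpace ℝ (Fin d)) (hu : ‖u‖ = 1) (a : ℝ) (ha : a < 1/2) :
    ∫ G : Fin D → EuclideanSpace ℝ (Fin d), Real.exp (a * ∑ j, ⟪u, G j⟫^2)
      ∂(Measure.pi fun _ => stdGaussian (EuclideanSpace ℝ (Fin d))) = ((√(1 - 2 * a))⁻¹)^D := by
  simp_rw [Finset.mul_sum, Real.exp_sum]
  rw [integral_fintype_prod_eq_prod (fun (_ : Fin D) (g : EuclideanSpace ℝ (Fin d)) => Real.exp (a * ⟪u, g⟫^2))]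
  simp [std_integral u hu a ha]

lemma row_integrable {d D : ℕ} (u : EuclideanSpace ℝ (Fin d)) (hu : ‖u‖ = 1) (a : ℝ) (ha : a < 1/2) :
    Integrable (fun G : Fin D → EuclideanSpace ℝ (Fin d) => Real.exp (a * ∑ j, ⟪u, G j⟫^2))
      (Measure.pi fun _ => stdGaussian (EuclideanSpace ℝ (Fin d))) := by
  simp_rw [Finset.mul_sum, Real.exp_sum]
  exact Integrable.fintype_prod (f := fun (_ : Fin D) (g : EuclideanSpace ℝ (Fin d)) => Real.exp (a * ⟪u, g⟫^2))
    (fun _ => std_integrable u hu a ha)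

lemma jl_exists {d D : ℕ} (hD : 0 < D) (X : Finset (EuclideanSpace ℝ (Fin d))) (δ : ℝ)
    (hδ : δ ∈ Set.Ioo (0:ℝ) 1) (hX : 2 * (X.card : ℝ) * Real.exp (-(D * δ^2 / 16)) < 1) :
    ∃ f : EuclideanSpace ℝ (Fin d) →ₗ[ℝ] EuclideanSpace ℝ (Fin D),
      ∀ x ∈ X, |‖f x‖^2 - ‖x‖^2| ≤ δ * ‖x‖^2 := by
  obtain ⟨hδ0, hδ1⟩ := hδ
  let X' := X.filter (fun x => x ≠ 0)
  let N : EuclideanSpace ℝ (Fin d) → EuclideanSpace ℝ (Fin d) := fun x => ‖x‖⁻¹ • x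
  have hN : ∀ x ∈ X', ‖N x‖ = 1 := by
    intro x hx
    have : x ≠ 0 := (Finset.mem_filter.1 hx).2
    simp [N, norm_smul, this]
  let S : (Fin D → EuclideanSpace ℝ (Fin d)) → EuclideanSpace ℝ (Fin d) → ℝ :=
    fun G x => ∑ j, ⟪N x, G j⟫^2
  let a := δ / 8
  let Φ : (Fin D → EuclideanSpace ℝ (Fin d)) → ℝ := fun G =>
    ∑ x ∈ X', (Real.exp (-(a * (1 + δ) * D)) * Real.exp (a * S G x)
      + Real.exp (a * (1 - δ) * D) * Real.exp (-a * S G x))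
  let μ : Measure (Fin D → EuclideanSpace ℝ (Fin d)) :=
    Measure.pi fun _ => stdGaussian (EuclideanSpace ℝ (Fin d))
  have ha : 0 < a := by positivity
  have ha4 : |a| ≤ 1/4 := by rw [abs_of_pos ha]; simp only [a]; linarith
  have ha2 : a < 1/2 := by simp only [a]; linarith
  have i1 : ∀ x ∈ X', Integrable (fun G => Real.exp (-(a * (1 + δ) * D)) * Real.exp (a * S G x)) μ :=
    fun x hx => (row_integrable (N x) (hN x hx) a ha2).const_mul _
  have i2 : ∀ x ∈ X', Integrable (fun G => Real.exp (a * (1 - δ) * D) * Real.exp (-a * S G x)) μ :=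
    fun x hx => (row_integrable (N x) (hN x hx) (-a) (by linarith)).const_mul _
  have iΦ : Integrable Φ μ := integrable_finsetSum _ fun x hx => (i1 x hx).add (i2 x hx)
  have hΦ : ∫ G, Φ G ∂μ < 1 := by
    have hs := integral_finsetSum (μ := μ) X' fun x hx => (i1 x hx).add (i2 x hx)
    simp only [Pi.add_apply] at hs
    simp only [Φ]
    rw [hs]
    have : ∀ x ∈ X', ∫ G, (Real.exp (-(a * (1 + δ) * D)) * Real.exp (a * S G x)
      + Real.exp (a * (1 - δ) * D) * Real.exp (-a * S G x)) ∂μ ≤ 2 * Real.exp (-(D * δ^2 / 16)) := by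
      intro x hx
      rw [integral_add (i1 x hx) (i2 x hx), integral_const_mul, integral_const_mul]
      simp only [S, μ]
      rw [row_integral (N x) (hN x hx) a ha2, row_integral (N x) (hN x hx) (-a) (by linarith), two_mul (Real.exp _)]
      have e1 : ((√(1 - 2 * a))⁻¹)^D ≤ Real.exp (D * (a + 4 * a^2)) := by
        rw [Real.exp_nat_mul]
        exact pow_le_pow_left₀ (by positivity) (mgf_bound a ha4) D
      have e2 : ((√(1 - 2 * -a))⁻¹)^D ≤ Real.exp (D * (-a + 4 * (-a)^2)) := by
        rw [Real.exp_nat_mul]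
        exact pow_le_pow_left₀ (by positivity) (mgf_bound (-a) (by rwa [abs_neg])) D
      apply add_le_add
      · refine (mul_le_mul_of_nonneg_left e1 (Real.exp_pos _).le).trans ?_
        rw [← Real.exp_add]
        apply Real.exp_le_exp.2
        simp only [a]
        apply le_of_eq; ring
      · refine (mul_le_mul_of_nonneg_left e2 (Real.exp_pos _).le).trans ?_
        rw [← Real.exp_add]
        apply Real.exp_le_exp.2
        simp only [a]
        apply le_of_eq; ring
    refine (Finset.sum_le_sum this).trans_lt ?_
    rw [Finset.sum_const, nsmul_eq_mul]
    refine lt_of_le_of_lt ?_ hX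
    have : (X'.card : ℝ) ≤ X.card := by exact_mod_cast Finset.card_filter_le _ _
    nlinarith [Real.exp_pos (-(D * δ^2 / 16))]
  obtain ⟨G, hG⟩ := exists_le_integral iΦ
  have hG1 : Φ G < 1 := hG.trans_lt hΦ
  let f : EuclideanSpace ℝ (Fin d) →ₗ[ℝ] EuclideanSpace ℝ (Fin D) :=
    { toFun := fun x => WithLp.toLp 2 fun j => (√D)⁻¹ * ⟪x, G j⟫
      map_add' := by intro x y; ext j; simp [inner_add_left, mul_add]
      map_smul' := by intro c x; ext j; simp [inner_smul_left]; ring }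
  have hDpos : (0:ℝ) < D := by exact_mod_cast hD
  have hf : ∀ x, ‖f x‖^2 = (D:ℝ)⁻¹ * ∑ j, ⟪x, G j⟫^2 := by
    intro x
    rw [EuclideanSpace.norm_sq_eq, Finset.mul_sum]
    refine Finset.sum_congr rfl fun j _ => ?_
    change ‖(√D)⁻¹ * ⟪x, G j⟫‖^2 = _
    rw [Real.norm_eq_abs, sq_abs, mul_pow, inv_pow, Real.sq_sqrt hDpos.le]
  refine ⟨f, fun x hx => ?_⟩
  by_cases hx0 : x = 0
  · subst hx0; simp
  have hx' : x ∈ X' := Finset.mem_filter.2 ⟨hx, hx0⟩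
  have hS : ‖f x‖^2 = (D:ℝ)⁻¹ * (‖x‖^2 * S G x) := by
    rw [hf]
    congr 1
    simp only [S, N, Finset.mul_sum]
    refine Finset.sum_congr rfl fun j _ => ?_
    have : ‖x‖ ≠ 0 := by simpa using hx0
    rw [inner_smul_left]
    simp
    field_simp
  have ht := (Finset.single_le_sum (f := fun x => (Real.exp (-(a * (1 + δ) * D)) * Real.exp (a * S G x)
      + Real.exp (a * (1 - δ) * D) * Real.exp (-a * S G x))) (fun y _ => by positivity) hx').trans_lt hG1
  simp only [← Real.exp_add] at ht
  have t1 := (lt_add_of_pos_right _ (Real.exp_pos (a * (1 - δ) * D + -a * S G x))).trans ht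
  have t2 := (lt_add_of_pos_left _ (Real.exp_pos (-(a * (1 + δ) * D) + a * S G x))).trans ht
  rw [Real.exp_lt_one_iff] at t1 t2
  have s1 : S G x ≤ (1 + δ) * D := by
    by_contra hc; push Not at hc; nlinarith
  have s2 : (1 - δ) * D ≤ S G x := by
    by_contra hc; push Not at hc; nlinarith
  have s1' : (D:ℝ)⁻¹ * S G x ≤ 1 + δ := by
    rw [inv_mul_le_iff₀ hDpos]; linarith
  have s2' : 1 - δ ≤ (D:ℝ)⁻¹ * S G x := by
    rw [le_inv_mul_iff₀ hDpos]; linarith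
  have e : ‖f x‖^2 = ‖x‖^2 * ((D:ℝ)⁻¹ * S G x) := by rw [hS]; ring
  rw [e, abs_le]
  constructor <;> nlinarith [sq_nonneg ‖x‖]

/-- Nine-ish test vectors suffice to control a linear map on a low dimensional subspace. -/
lemma subspace_test {d : ℕ} (W : Submodule ℝ (EuclideanSpace ℝ (Fin d)))
    (hW : Module.finrank ℝ W ≤ 3) :
    ∃ Y : Finset (EuclideanSpace ℝ (Fin d)), Y.card ≤ 18 ∧
      ∀ (D : ℕ) (f : EuclideanSpace ℝ (Fin d) →ₗ[ℝ] EuclideanSpace ℝ (Fin D)) (δ : ℝ), 0 ≤ δ →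
        (∀ y ∈ Y, |‖f y‖^2 - ‖y‖^2| ≤ δ * ‖y‖^2) →
        ∀ w ∈ W, |‖f w‖^2 - ‖w‖^2| ≤ 3 * δ * ‖w‖^2 := by
  set r := Module.finrank ℝ W with hr
  let b := stdOrthonormalBasis ℝ W
  let e : Fin r → EuclideanSpace ℝ (Fin d) := fun i => (b i : EuclideanSpace ℝ (Fin d))
  have he : ∀ i, ‖e i‖ = 1 := fun i => b.orthonormal.1 i
  refine ⟨(Finset.univ : Finset (Fin r × Fin r)).image (fun p => e p.1 + e p.2) ∪
    (Finset.univ : Finset (Fin r × Fin r)).image (fun p => e p.1 - e p.2), ?_, ?_⟩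
  · refine (Finset.card_union_le _ _).trans ?_
    have h1 := Finset.card_image_le (s := (Finset.univ : Finset (Fin r × Fin r))) (f := fun p => e p.1 + e p.2)
    have h2 := Finset.card_image_le (s := (Finset.univ : Finset (Fin r × Fin r))) (f := fun p => e p.1 - e p.2)
    simp only [Finset.card_univ, Fintype.card_prod, Fintype.card_fin] at h1 h2
    nlinarith
  · intro D f δ hδ hY w hw
    let B : Fin r → Fin r → ℝ := fun i j => ⟪f (e i), f (e j)⟫ - ⟪e i, e j⟫
    have hB : ∀ i j, |B i j| ≤ δ := by
      intro i j
      have h1 := abs_le.1 (hY (e i + e j) (Finset.mem_union_left _ (Finset.mem_image.2 ⟨(i,j), Finset.mem_univ _, rfl⟩)))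
      have h2 := abs_le.1 (hY (e i - e j) (Finset.mem_union_right _ (Finset.mem_image.2 ⟨(i,j), Finset.mem_univ _, rfl⟩)))
      rw [map_add, norm_add_sq_real, norm_add_sq_real] at h1
      rw [map_sub, norm_sub_sq_real, norm_sub_sq_real] at h2
      rw [he i, he j] at h1 h2
      rw [abs_le]
      simp only [B]
      constructor <;> nlinarith
    let c : Fin r → ℝ := fun i => b.repr ⟨w, hw⟩ i
    have hwc : w = ∑ i, c i • e i := by
      have := congrArg (Subtype.val) (b.sum_repr ⟨w, hw⟩)
      simpa [c, e] using this.symm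
    have hq : ‖f w‖^2 - ‖w‖^2 = ∑ i, ∑ j, c i * c j * B i j := by
      rw [← real_inner_self_eq_norm_sq, ← real_inner_self_eq_norm_sq]
      conv_lhs => rw [hwc]
      simp only [map_sum, map_smul, sum_inner, inner_sum, inner_smul_left, inner_smul_right,
        ← Finset.sum_sub_distrib, B]
      refine Finset.sum_congr rfl fun i _ => ?_
      rw [Finset.mul_sum, Finset.mul_sum, ← Finset.sum_sub_distrib]
      refine Finset.sum_congr rfl fun j _ => ?_
      rw [real_inner_comm (f (e i)), real_inner_comm (e i)]
      simp only [conj_trivial]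
      ring
    have hn : ‖w‖^2 = ∑ i, c i ^ 2 := by
      have h1 : ‖w‖ = ‖b.repr ⟨w, hw⟩‖ := by rw [b.repr.norm_map]; rfl
      rw [h1, EuclideanSpace.norm_sq_eq]
      simp only [Real.norm_eq_abs, sq_abs]
      rfl
    rw [hq]
    calc |∑ i, ∑ j, c i * c j * B i j| ≤ ∑ i, ∑ j, |c i| * |c j| * δ := by
          refine (Finset.abs_sum_le_sum_abs _ _).trans (Finset.sum_le_sum fun i _ => ?_)
          refine (Finset.abs_sum_le_sum_abs _ _).trans (Finset.sum_le_sum fun j _ => ?_)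
          rw [abs_mul, abs_mul]
          exact mul_le_mul_of_nonneg_left (hB i j) (by positivity)
      _ = δ * (∑ i, |c i|)^2 := by
          rw [sq, Finset.sum_mul_sum, Finset.mul_sum]
          refine Finset.sum_congr rfl fun i _ => ?_
          rw [Finset.mul_sum]
          exact Finset.sum_congr rfl fun j _ => by ring
      _ ≤ δ * (3 * ∑ i, c i^2) := by
          refine mul_le_mul_of_nonneg_left ?_ hδ
          have := sq_sum_le_card_mul_sum_sq (s := (Finset.univ : Finset (Fin r))) (f := fun i => |c i|)
          simp only [Finset.card_univ, Fintype.card_fin, sq_abs] at this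
          refine this.trans ?_
          have h3 : (r:ℝ) ≤ 3 := by exact_mod_cast hW
          exact mul_le_mul_of_nonneg_right h3 (Finset.sum_nonneg fun i _ => sq_nonneg _)
      _ = 3 * δ * ‖w‖^2 := by rw [hn]; ring

/-- Difference of two points on segments. -/
lemma quad_test {d : ℕ} (a b c e : EuclideanSpace ℝ (Fin d)) :
    ∃ Y : Finset (EuclideanSpace ℝ (Fin d)), Y.card ≤ 18 ∧
      ∀ (D : ℕ) (f : EuclideanSpace ℝ (Fin d) →ₗ[ℝ] EuclideanSpace ℝ (Fin D)) (δ : ℝ), 0 ≤ δ →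
        (∀ y ∈ Y, |‖f y‖^2 - ‖y‖^2| ≤ δ * ‖y‖^2) →
        ∀ s t : ℝ, |‖f (((1 - s) • a + s • b) - ((1 - t) • c + t • e))‖^2
            - ‖((1 - s) • a + s • b) - ((1 - t) • c + t • e)‖^2|
          ≤ 3 * δ * ‖((1 - s) • a + s • b) - ((1 - t) • c + t • e)‖^2 := by
  let v : Fin 3 → EuclideanSpace ℝ (Fin d) := ![a - c, b - a, e - c]
  obtain ⟨Y, hY, h⟩ := subspace_test (Submodule.span ℝ (Set.range v))
    ((finrank_range_le_card v).trans (by simp))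
  refine ⟨Y, hY, fun D f δ hδ hy s t => h D f δ hδ hy _ ?_⟩
  have m0 : a - c ∈ Submodule.span ℝ (Set.range v) := Submodule.subset_span ⟨0, rfl⟩
  have m1 : b - a ∈ Submodule.span ℝ (Set.range v) := Submodule.subset_span ⟨1, rfl⟩
  have m2 : e - c ∈ Submodule.span ℝ (Set.range v) := Submodule.subset_span ⟨2, rfl⟩
  have : ((1 - s) • a + s • b) - ((1 - t) • c + t • e) = (a - c) + s • (b - a) - t • (e - c) := by
    module
  rw [this]
  exact Submodule.sub_mem _ (Submodule.add_mem _ m0 (Submodule.smul_mem _ _ m1)) (Submodule.smul_mem _ _ m2)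

/-- The main embedding lemma. -/
lemma embed_exists {d D N : ℕ} (hN : 2 ≤ N) (P Z : Finset (EuclideanSpace ℝ (Fin d)))
    (hP : P.card ≤ 2 * N) (hZ : Z.card ≤ N^2) (ε : ℝ) (hε : ε ∈ Set.Ioo (0:ℝ) 1)
    (hD : 3000 * ε⁻¹^2 * Real.log N ≤ D) :
    ∃ f : EuclideanSpace ℝ (Fin d) →ₗ[ℝ] EuclideanSpace ℝ (Fin D),
      (∀ z ∈ Z, z ≠ 0 → f z ≠ 0) ∧
      ∀ a ∈ P, ∀ b ∈ P, ∀ c ∈ P, ∀ e ∈ P, ∀ s t : ℝ,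
        (1 - ε) * ‖((1 - s) • a + s • b) - ((1 - t) • c + t • e)‖
          ≤ ‖f ((1 - s) • a + s • b) - f ((1 - t) • c + t • e)‖ ∧
        ‖f ((1 - s) • a + s • b) - f ((1 - t) • c + t • e)‖
          ≤ (1 + ε) * ‖((1 - s) • a + s • b) - ((1 - t) • c + t • e)‖ := by
  obtain ⟨hε0, hε1⟩ := hε
  choose Y hYc hY using @quad_test d
  let X := Z ∪ (P ×ˢ P ×ˢ P ×ˢ P).biUnion (fun p => Y p.1 p.2.1 p.2.2.1 p.2.2.2)
  have hlogpos : 0 < Real.log N := Real.log_pos (by exact_mod_cast hN)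
  have hXc : X.card ≤ N^14 := by
    have h1 : ((P ×ˢ P ×ˢ P ×ˢ P).biUnion (fun p => Y p.1 p.2.1 p.2.2.1 p.2.2.2)).card
        ≤ (P.card * (P.card * (P.card * P.card))) * 18 := by
      refine (Finset.card_biUnion_le_card_mul _ _ 18 fun p _ => hYc _ _ _ _).trans ?_
      simp [Finset.card_product]
    have h2 : P.card * (P.card * (P.card * P.card)) ≤ (2*N) * ((2*N) * ((2*N)*(2*N))) := by gcongr
    have h3 := Finset.card_union_le Z ((P ×ˢ P ×ˢ P ×ˢ P).biUnion (fun p => Y p.1 p.2.1 p.2.2.1 p.2.2.2))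
    have h4 : N^2 ≤ N^4 := Nat.pow_le_pow_right (by omega) (by norm_num)
    have h5 : 2^10 ≤ N^10 := Nat.pow_le_pow_left hN 10
    have h6 : N^14 = N^10 * N^4 := by ring
    calc X.card ≤ N^4 + 288 * N^4 := by
          refine h3.trans (add_le_add (hZ.trans h4) (h1.trans ?_))
          refine (Nat.mul_le_mul_right 18 h2).trans (le_of_eq ?_)
          ring
      _ ≤ N^14 := by rw [h6]; nlinarith [Nat.zero_le (N^4)]
  have hDpos : (0:ℝ) < D := lt_of_lt_of_le (by positivity) hD
  have hNpos : (0:ℝ) < N := by exact_mod_cast (by omega : 0 < N)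
  obtain ⟨f, hf⟩ := jl_exists (D := D) (by exact_mod_cast hDpos) X (ε/3) ⟨by positivity, by linarith⟩ (by
    have h1 : 2 * (X.card : ℝ) ≤ (N:ℝ)^15 := by
      have : 2 * X.card ≤ N^15 := by
        calc 2 * X.card ≤ N * N^14 := Nat.mul_le_mul hN hXc
          _ = N^15 := by ring
      exact_mod_cast this
    have h2 : 16 * Real.log N ≤ D * (ε/3)^2 / 16 := by
      have h3 : 3000 * Real.log N ≤ D * ε^2 := by
        have := mul_le_mul_of_nonneg_right hD (sq_nonneg ε)
        have e : 3000 * ε⁻¹^2 * Real.log N * ε^2 = 3000 * Real.log N := by field_simp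
        rwa [e] at this
      nlinarith
    have h3 : Real.exp (-(D * (ε/3)^2 / 16)) ≤ ((N:ℝ)^16)⁻¹ := by
      rw [← Real.exp_log (pow_pos hNpos 16), ← Real.exp_neg, Real.log_pow]
      apply Real.exp_le_exp.2
      push_cast; linarith
    calc 2 * (X.card : ℝ) * Real.exp (-(D * (ε/3)^2 / 16)) ≤ (N:ℝ)^15 * ((N:ℝ)^16)⁻¹ := by gcongr
      _ = (N:ℝ)⁻¹ := by field_simp
      _ < 1 := inv_lt_one_of_one_lt₀ (by exact_mod_cast hN))
  refine ⟨f, ?_, ?_⟩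
  · intro z hz hz0 hfz
    have := abs_le.1 (hf z (Finset.mem_union_left _ hz))
    rw [hfz] at this
    have hp : 0 < ‖z‖ := by simpa using hz0
    simp at this
    nlinarith [pow_pos hp 2]
  · intro a ha b hb c hc e he s t
    have := hY a b c e D f (ε/3) (by positivity) (fun y hy => hf y (Finset.mem_union_right _
      (Finset.mem_biUnion.2 ⟨(a,b,c,e), by simp [ha,hb,hc,he], hy⟩))) s t
    rw [← map_sub]
    set w := ((1 - s) • a + s • b) - ((1 - t) • c + t • e)
    have h := abs_le.1 this
    constructor
    · apply le_of_sq_le_sq _ (norm_nonneg _)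
      rw [mul_pow]
      nlinarith [mul_nonneg (mul_nonneg hε0.le (sub_nonneg.2 hε1.le)) (sq_nonneg ‖w‖)]
    · apply le_of_sq_le_sq _ (by positivity)
      rw [mul_pow]
      nlinarith [mul_nonneg (mul_nonneg hε0.le hε0.le) (sq_nonneg ‖w‖), mul_nonneg hε0.le (sq_nonneg ‖w‖)]

end JL

section Curves

lemma PolyCurve.vertex_eq {d : ℕ} (τ : PolyCurve d) (i : Fin τ.m) :
    τ.vertex i = τ.toFun (τ.instant i) := by
  have h2 := τ.two_le
  by_cases hi : (i : ℕ) + 1 < τ.m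
  · have := τ.affine_on_segments i ⟨i + 1, hi⟩ rfl 0 (by simp)
    simpa using this.symm
  · have := τ.affine_on_segments ⟨i - 1, by omega⟩ i (by simp; omega) 1 (by simp)
    simpa using this.symm

/-- every point of the curve lies on a segment -/
lemma PolyCurve.exists_seg {d : ℕ} (τ : PolyCurve d) (t : ℝ) (ht : t ∈ Set.Icc (0:ℝ) 1) :
    ∃ i j : Fin τ.m, ∃ s ∈ Set.Icc (0:ℝ) 1,
      τ.toFun t = (1 - s) • τ.vertex i + s • τ.vertex j := by
  have key : ∀ k : ℕ, ∀ hk : k < τ.m, t ≤ τ.instant ⟨k, hk⟩ →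
      ∃ i j : Fin τ.m, ∃ s ∈ Set.Icc (0:ℝ) 1,
      τ.toFun t = (1 - s) • τ.vertex i + s • τ.vertex j := by
    intro k
    induction k with
    | zero =>
      intro hk h
      rw [τ.instant_first] at h
      have : t = 0 := le_antisymm h ht.1
      refine ⟨⟨0, hk⟩, ⟨0, hk⟩, 0, by simp, ?_⟩
      rw [τ.vertex_eq, τ.instant_first, this]
      simp
    | succ k ih =>
      intro hk h
      by_cases h' : t ≤ τ.instant ⟨k, by omega⟩
      · exact ih _ h'
      · push Not at h'
        set x := τ.instant ⟨k, by omega⟩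
        set y := τ.instant ⟨k+1, hk⟩
        have hxy : 0 < y - x := by linarith
        refine ⟨⟨k, by omega⟩, ⟨k+1, hk⟩, (t - x) / (y - x), ⟨?_, ?_⟩, ?_⟩
        · exact div_nonneg (by linarith) hxy.le
        · rw [div_le_one hxy]; linarith
        · rw [← τ.affine_on_segments ⟨k, by omega⟩ ⟨k+1, hk⟩ rfl ((t - x) / (y - x)) ⟨div_nonneg (by linarith) hxy.le, by rw [div_le_one hxy]; linarith⟩]
          congr 1
          change t = (1 - (t - x) / (y - x)) * x + (t - x) / (y - x) * y
          field_simp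
          ring
  refine key (τ.m - 1) (Nat.sub_lt τ.m_pos one_pos) ?_
  rw [τ.instant_last]
  exact ht.2

lemma PolyCurve.bdd {d : ℕ} (τ : PolyCurve d) : ∃ M, ∀ t ∈ Set.Icc (0:ℝ) 1, ‖τ.toFun t‖ ≤ M := by
  refine ⟨∑ i, ‖τ.vertex i‖ , fun t ht => ?_⟩
  obtain ⟨i, j, s, hs, h⟩ := τ.exists_seg t ht
  have hv : ∀ i, ‖τ.vertex i‖ ≤ ∑ i, ‖τ.vertex i‖ := fun i =>
    Finset.single_le_sum (f := fun i => ‖τ.vertex i‖) (fun _ _ => norm_nonneg _) (Finset.mem_univ i)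
  rw [h]
  refine (norm_add_le _ _).trans ?_
  rw [norm_smul, norm_smul, Real.norm_of_nonneg hs.1, Real.norm_of_nonneg (sub_nonneg.2 hs.2)]
  nlinarith [hv i, hv j, mul_le_mul_of_nonneg_left (hv i) (sub_nonneg.2 hs.2), mul_le_mul_of_nonneg_left (hv j) hs.1]

lemma bdd_range {d : ℕ} (σ τ : PolyCurve d) {φ ψ : ℝ → ℝ} (hφ : IsReparam φ) (hψ : IsReparam ψ) :
    BddAbove (Set.range fun t : Set.Icc (0:ℝ) 1 => ‖σ.toFun (φ t.1) - τ.toFun (ψ t.1)‖) := by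
  obtain ⟨M, hM⟩ := σ.bdd
  obtain ⟨M', hM'⟩ := τ.bdd
  refine ⟨M + M', ?_⟩
  rintro _ ⟨t, rfl⟩
  exact (norm_sub_le _ _).trans (add_le_add (hM _ (hφ.1.2.1 t.2)) (hM' _ (hψ.1.2.1 t.2)))

lemma isReparam_id_s10 : IsReparam (fun x => x) :=
  ⟨⟨continuousOn_id, fun _ h => h, rfl, rfl⟩, Set.bijOn_id _⟩

lemma IsReparam.comp {φ ψ : ℝ → ℝ} (hφ : IsReparam φ) (hψ : IsReparam ψ) :
    IsReparam (fun x => φ (ψ x)) :=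
  ⟨⟨hφ.1.1.comp hψ.1.1 hψ.1.2.1, hφ.1.2.1.comp hψ.1.2.1, by simp [hψ.1.2.2.1, hφ.1.2.2.1],
    by simp [hψ.1.2.2.2, hφ.1.2.2.2]⟩, hφ.2.comp hψ.2⟩

lemma IsReparam.exists_inv {φ : ℝ → ℝ} (hφ : IsReparam φ) :
    ∃ ψ, IsReparam ψ ∧ ∀ t ∈ Set.Icc (0:ℝ) 1, φ (ψ t) = t := by
  have hinv := hφ.2.invOn_invFunOn
  have hb : Set.BijOn (Function.invFunOn φ (Set.Icc 0 1)) (Set.Icc 0 1) (Set.Icc 0 1) :=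
    hφ.2.symm ⟨hinv.2, hinv.1⟩
  refine ⟨Function.invFunOn φ (Set.Icc 0 1), ⟨⟨?_, hb.mapsTo, ?_, ?_⟩, hb⟩, hinv.2⟩
  · let e : Set.Icc (0:ℝ) 1 ≃ Set.Icc (0:ℝ) 1 := hφ.2.equiv
    have he : Continuous e := by
      have := (continuousOn_iff_continuous_domRestrict.1 hφ.1.1)
      exact this.subtype_mk _
    have hes : Continuous e.symm := (he.homeoOfEquivCompactToT2 (f := e)).symm.continuous
    rw [continuousOn_iff_continuous_domRestrict]
    have : (Set.Icc (0:ℝ) 1).domRestrict (Function.invFunOn φ (Set.Icc 0 1)) = fun t => (e.symm t : ℝ) := by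
      funext t
      have h1 : φ (e.symm t) = t := congrArg Subtype.val (e.apply_symm_apply t)
      have h2 := hinv.1 (e.symm t).2
      rw [h1] at h2
      exact h2
    rw [this]
    exact continuous_subtype_val.comp hes
  · have := hinv.1 (show (0:ℝ) ∈ Set.Icc (0:ℝ) 1 by simp)
    rwa [hφ.1.2.2.1] at this
  · have := hinv.1 (show (1:ℝ) ∈ Set.Icc (0:ℝ) 1 by simp)
    rwa [hφ.1.2.2.2] at this

lemma fd_bddBelow {d : ℕ} (σ τ : PolyCurve d) : BddBelow { r | ∃ φ ψ : ℝ → ℝ, IsReparam φ ∧ IsReparam ψ ∧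
    r = ⨆ t : Set.Icc (0:ℝ) 1, ‖σ.toFun (φ t.1) - τ.toFun (ψ t.1)‖ } := by
  refine ⟨0, ?_⟩
  rintro _ ⟨φ, ψ, _, _, rfl⟩
  exact Real.iSup_nonneg fun _ => norm_nonneg _

lemma fd_nonempty {d : ℕ} (σ τ : PolyCurve d) : { r | ∃ φ ψ : ℝ → ℝ, IsReparam φ ∧ IsReparam ψ ∧
    r = ⨆ t : Set.Icc (0:ℝ) 1, ‖σ.toFun (φ t.1) - τ.toFun (ψ t.1)‖ }.Nonempty :=
  ⟨_, _, _, isReparam_id_s10, isReparam_id_s10, rfl⟩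

lemma fd_nonneg {d : ℕ} (σ τ : PolyCurve d) : 0 ≤ frechetDist σ τ := by
  apply Real.sInf_nonneg
  rintro _ ⟨φ, ψ, _, _, rfl⟩
  exact Real.iSup_nonneg fun _ => norm_nonneg _

lemma fd_symm {d : ℕ} (σ τ : PolyCurve d) : frechetDist σ τ = frechetDist τ σ := by
  unfold frechetDist
  congr 1
  ext r
  constructor <;>
  · rintro ⟨φ, ψ, h1, h2, rfl⟩
    exact ⟨ψ, φ, h2, h1, by simp_rw [norm_sub_rev]⟩

/-- upper bounds on the Fréchet distance -/
lemma fd_le {d : ℕ} {σ τ : PolyCurve d} {φ ψ : ℝ → ℝ} (hφ : IsReparam φ) (hψ : IsReparam ψ) {r : ℝ}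
    (h : ∀ t ∈ Set.Icc (0:ℝ) 1, ‖σ.toFun (φ t) - τ.toFun (ψ t)‖ ≤ r) : frechetDist σ τ ≤ r := by
  have : Nonempty (Set.Icc (0:ℝ) 1) := ⟨⟨0, by simp⟩⟩
  exact (csInf_le (fd_bddBelow σ τ) ⟨φ, ψ, hφ, hψ, rfl⟩).trans (ciSup_le fun t => h t.1 t.2)

lemma fd_lt {d : ℕ} {σ τ : PolyCurve d} {r : ℝ} (h : frechetDist σ τ < r) :
    ∃ φ ψ : ℝ → ℝ, IsReparam φ ∧ IsReparam ψ ∧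
      ∀ t ∈ Set.Icc (0:ℝ) 1, ‖σ.toFun (φ t) - τ.toFun (ψ t)‖ ≤ r := by
  obtain ⟨_, ⟨φ, ψ, h1, h2, rfl⟩, hr⟩ := exists_lt_of_csInf_lt (fd_nonempty σ τ) h
  exact ⟨φ, ψ, h1, h2, fun t ht => (le_ciSup (bdd_range σ τ h1 h2) ⟨t, ht⟩).trans hr.le⟩

lemma fd_triangle {d : ℕ} (σ ρ τ : PolyCurve d) :
    frechetDist σ τ ≤ frechetDist σ ρ + frechetDist ρ τ := by
  apply le_of_forall_pos_le_add
  intro η hη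
  obtain ⟨φ₁, ψ₁, a1, b1, h1⟩ := fd_lt (σ := σ) (τ := ρ) (lt_add_of_pos_right _ (half_pos hη))
  obtain ⟨φ₂, ψ₂, a2, b2, h2⟩ := fd_lt (σ := ρ) (τ := τ) (lt_add_of_pos_right _ (half_pos hη))
  obtain ⟨χ₁, c1, e1⟩ := b1.exists_inv
  obtain ⟨χ₂, c2, e2⟩ := a2.exists_inv
  refine fd_le (a1.comp c1) (b2.comp c2) fun t ht => ?_
  have k1 := h1 _ (c1.1.2.1 ht)
  have k2 := h2 _ (c2.1.2.1 ht)
  rw [e1 t ht] at k1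
  rw [e2 t ht] at k2
  have := norm_sub_le_norm_sub_add_norm_sub (σ.toFun (φ₁ (χ₁ t))) (ρ.toFun t) (τ.toFun (ψ₂ (χ₂ t)))
  linarith

/-- comparison of Fréchet distances -/
lemma fd_compare {d d' : ℕ} {σ τ : PolyCurve d} {σ' τ' : PolyCurve d'} {K : ℝ} (hK : 0 ≤ K)
    (h : ∀ s ∈ Set.Icc (0:ℝ) 1, ∀ t ∈ Set.Icc (0:ℝ) 1,
      ‖σ'.toFun s - τ'.toFun t‖ ≤ K * ‖σ.toFun s - τ.toFun t‖) :
    frechetDist σ' τ' ≤ K * frechetDist σ τ := by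
  apply le_of_forall_pos_le_add
  intro η hη
  obtain ⟨φ, ψ, a, b, h1⟩ := fd_lt (σ := σ) (τ := τ) (lt_add_of_pos_right _ (div_pos hη (by linarith : 0 < K + 1)))
  refine fd_le a b fun t ht => (h _ (a.1.2.1 ht) _ (b.1.2.1 ht)).trans ?_
  refine (mul_le_mul_of_nonneg_left (h1 t ht) hK).trans ?_
  rw [mul_add]
  have : K * (η / (K+1)) ≤ η := by
    rw [mul_div_assoc', div_le_iff₀ (by linarith)]; nlinarith
  linarith

/-- In positive dimension there are infinitely many curves of complexity two. -/
def lineCurve {d : ℕ} (v : EuclideanSpace ℝ (Fin d)) : PolyCurve d where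
  m := 2
  m_pos := by norm_num
  vertex := fun _ => v
  instant := fun i => (i : ℕ)
  toFun := fun _ => v
  instant_strictMono := by intro i j h; simpa using h
  instant_first := by simp
  instant_last := by simp
  affine_on_segments := by intro i j _ s _; module

lemma exists_superset_card {d k : ℕ} (hd : 0 < d) {ℓ : ℕ} (hℓ : 2 ≤ ℓ) (C : Finset (PolyCurve d))
    (hC : C.card ≤ k) (hm : ∀ c ∈ C, c.m ≤ ℓ) :
    ∃ C' : Finset (PolyCurve d), C ⊆ C' ∧ C'.card = k ∧ ∀ c ∈ C', c.m ≤ ℓ := by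
  have hinj : Function.Injective (lineCurve (d := d)) := by
    intro v w h
    exact congrFun (congrArg PolyCurve.toFun h) 0
  have : Nonempty (Fin d) := ⟨⟨0, hd⟩⟩
  have hinf : {c : PolyCurve d | c.m ≤ ℓ}.Infinite := by
    have : Infinite (EuclideanSpace ℝ (Fin d)) := Module.Free.infinite ℝ _
    exact (Set.infinite_range_of_injective hinj).mono (by rintro _ ⟨v, rfl⟩; exact hℓ)
  obtain ⟨t, ht, htc⟩ := (hinf.sdiff C.finite_toSet).exists_subset_card_eq (k - C.card)
  refine ⟨C ∪ t, Finset.subset_union_left, ?_, ?_⟩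
  · rw [Finset.card_union_of_disjoint, htc]
    · omega
    · rw [Finset.disjoint_left]
      intro c hc hct
      exact (ht hct).2 hc
  · intro c hc
    rcases Finset.mem_union.1 hc with h | h
    · exact hm c h
    · exact (ht h).1

/-- assignment cost -/
lemma cost_le {d : ℕ} (τ : PolyCurve d) (C : Finset (PolyCurve d)) {c : PolyCurve d} (hc : c ∈ C) :
    sInf ((fun c => frechetDist τ c) '' ↑C) ≤ frechetDist τ c :=
  csInf_le ⟨0, by rintro _ ⟨c, _, rfl⟩; exact fd_nonneg _ _⟩ ⟨c, hc, rfl⟩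

lemma cost_nonneg {d : ℕ} (τ : PolyCurve d) (C : Finset (PolyCurve d)) :
    0 ≤ sInf ((fun c => frechetDist τ c) '' ↑C) :=
  Real.sInf_nonneg (by rintro _ ⟨c, _, rfl⟩; exact fd_nonneg _ _)

lemma cost_attained {d : ℕ} (τ : PolyCurve d) (C : Finset (PolyCurve d)) (hC : C.Nonempty) :
    ∃ c ∈ C, frechetDist τ c = sInf ((fun c => frechetDist τ c) '' ↑C) := by
  have h := (Set.Nonempty.image (fun c => frechetDist τ c) (Finset.coe_nonempty.2 hC)).csInf_mem
    (C.finite_toSet.image _)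
  exact h

lemma kMedianCost_le {d k ℓ : ℕ} (T C : Finset (PolyCurve d)) (h1 : C.card = k) (h2 : ∀ c ∈ C, c.m ≤ ℓ) :
    kMedianCost k ℓ T ≤ ∑ τ ∈ T, sInf ((fun c => frechetDist τ c) '' ↑C) := by
  refine csInf_le ⟨0, ?_⟩ ⟨C, h1, h2, rfl⟩
  rintro _ ⟨C, _, _, rfl⟩
  exact Finset.sum_nonneg fun τ _ => cost_nonneg τ C

lemma kMedianCost_nonneg {d k ℓ : ℕ} (T : Finset (PolyCurve d)) : 0 ≤ kMedianCost k ℓ T := by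
  apply Real.sInf_nonneg
  rintro _ ⟨C, _, _, rfl⟩
  exact Finset.sum_nonneg fun τ _ => cost_nonneg τ C

lemma kMedianCost_zero {d ℓ : ℕ} (T : Finset (PolyCurve d)) : kMedianCost 0 ℓ T = 0 := by
  unfold kMedianCost
  have : { r | ∃ C : Finset (PolyCurve d), C.card = 0 ∧ (∀ c ∈ C, c.m ≤ ℓ) ∧
    r = ∑ τ ∈ T, sInf ((fun c => frechetDist τ c) '' ↑C) } = {0} := by
    ext r
    constructor
    · rintro ⟨C, h, _, rfl⟩
      rw [Finset.card_eq_zero] at h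
      subst h
      simp
    · rintro rfl
      exact ⟨∅, rfl, by simp, by simp⟩
  rw [this, csInf_singleton]

lemma map_inj {d d' : ℕ} (f : EuclideanSpace ℝ (Fin d) →ₗ[ℝ] EuclideanSpace ℝ (Fin d'))
    (σ τ : PolyCurve d) (hf : σ.toFun = τ.toFun) (h : PolyCurve.map f σ = PolyCurve.map f τ) : σ = τ := by
  have vs := σ.vertex_eq
  have vt := τ.vertex_eq
  obtain ⟨m, mp, v, i, g, _, _, _, _⟩ := σ
  obtain ⟨m', mp', v', i', g', _, _, _, _⟩ := τ
  simp only [PolyCurve.map, PolyCurve.mk.injEq] at h hf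
  obtain ⟨rfl, _, h2, _⟩ := h
  obtain rfl := eq_of_heq h2
  subst hf
  have : v = v' := by funext j; exact (vs j).trans (vt j).symm
  subst this
  rfl

end Curves

/-- dimension reduction to O(ε⁻² log(nℓ)) dimensions preserving the optimal
(k,ℓ)-median cost within a factor, for unrestricted medians (ℓ ≥ m). -/
theorem statement10 : ∃ C : ℝ, 0 < C ∧
    ∀ (d n m k ℓ : ℕ) (T : Finset (PolyCurve d)), T.card = n → (∀ τ ∈ T, τ.m ≤ m) →
      m ≤ ℓ → 2 ≤ n * ℓ → ∀ ε : ℝ, ε ∈ Set.Ioo (0:ℝ) 1 →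
      (∃ Cstar : Finset (PolyCurve d), Cstar.card = k ∧ (∀ c ∈ Cstar, c.m ≤ ℓ) ∧
        ∑ τ ∈ T, sInf ((fun c => frechetDist τ c) '' ↑Cstar) = kMedianCost k ℓ T) →
      ∃ (d' : ℕ) (f : EuclideanSpace ℝ (Fin d) →ₗ[ℝ] EuclideanSpace ℝ (Fin d')),
        d' ≤ ⌈C * ε⁻¹ ^ 2 * Real.log ((n : ℝ) * (ℓ : ℝ))⌉₊ ∧
        ((1 - ε) / 2) * kMedianCost k ℓ T ≤ kMedianCost k ℓ (T.image (PolyCurve.map f)) ∧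
        kMedianCost k ℓ (T.image (PolyCurve.map f)) ≤ (1 + ε) * kMedianCost k ℓ T := by
  refine ⟨3000, by norm_num, ?_⟩
  intro d n m k ℓ T hn hTm hmℓ hnℓ ε hε hstar
  have hε0 := hε.1
  have hε1 := hε.2
  have hr := kMedianCost_nonneg (k := k) (ℓ := ℓ) T
  rcases Nat.eq_zero_or_pos d with rfl | hd
  · refine ⟨0, LinearMap.id, Nat.zero_le _, ?_⟩
    have : T.image (PolyCurve.map LinearMap.id) = T := by
      have h : (PolyCurve.map LinearMap.id : PolyCurve 0 → PolyCurve 0) = id := rfl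
      rw [h, Finset.image_id]
    rw [this]
    constructor <;> nlinarith
  rcases Nat.eq_zero_or_pos k with rfl | hk
  · refine ⟨0, 0, Nat.zero_le _, ?_⟩
    simp [kMedianCost_zero]
  obtain ⟨Cs, hCk, hCm, hCs⟩ := hstar
  have hCne : Cs.Nonempty := Finset.card_pos.1 (by omega)
  have hnpos : 0 < n := Nat.pos_of_ne_zero (by rintro rfl; simp at hnℓ)
  have hTne : T.Nonempty := Finset.card_pos.1 (by omega)
  have hℓ2 : 2 ≤ ℓ := by
    obtain ⟨τ, hτ⟩ := hTne
    exact (τ.two_le.trans (hTm τ hτ)).trans hmℓ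
  have hTℓ : ∀ τ ∈ T, τ.m ≤ ℓ := fun τ hτ => (hTm τ hτ).trans hmℓ
  choose cc hccm hcc using fun τ : PolyCurve d => cost_attained τ Cs hCne
  let S := T ∪ T.image cc
  have hSm : ∀ σ ∈ S, σ.m ≤ ℓ := by
    intro σ hσ
    rcases Finset.mem_union.1 hσ with h | h
    · exact hTℓ σ h
    · obtain ⟨τ, _, rfl⟩ := Finset.mem_image.1 h
      exact hCm _ (hccm τ)
  have hSc : S.card ≤ 2 * n := by
    have h1 := Finset.card_union_le T (T.image cc)
    have h2 := Finset.card_image_le (s := T) (f := cc)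
    simp only [S]; omega
  let P := S.biUnion (fun σ => Finset.univ.image σ.vertex)
  have hPc : P.card ≤ 2 * (n * ℓ) := by
    have h1 : P.card ≤ S.card * ℓ := Finset.card_biUnion_le_card_mul _ _ _ fun σ hσ =>
      Finset.card_image_le.trans (by simpa using hSm σ hσ)
    calc P.card ≤ S.card * ℓ := h1
      _ ≤ 2 * n * ℓ := Nat.mul_le_mul_right _ hSc
      _ = _ := by ring
  have hPv : ∀ σ ∈ S, ∀ i, σ.vertex i ∈ P := fun σ hσ i =>
    Finset.mem_biUnion.2 ⟨σ, hσ, Finset.mem_image.2 ⟨i, Finset.mem_univ _, rfl⟩⟩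
  have hw : ∀ p : PolyCurve d × PolyCurve d, ∃ z : EuclideanSpace ℝ (Fin d), p.1.toFun ≠ p.2.toFun →
      z ≠ 0 ∧ ∃ t, z = p.1.toFun t - p.2.toFun t := by
    intro p
    by_cases h : p.1.toFun = p.2.toFun
    · exact ⟨0, fun h' => absurd h h'⟩
    · obtain ⟨t, ht⟩ := Function.ne_iff.1 h
      exact ⟨p.1.toFun t - p.2.toFun t, fun _ => ⟨sub_ne_zero.2 ht, t, rfl⟩⟩
  choose w hw using hw
  let Z := (T ×ˢ T).image w
  have hZc : Z.card ≤ (n * ℓ)^2 := by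
    refine Finset.card_image_le.trans ?_
    rw [Finset.card_product, hn, mul_pow, ← sq]
    exact Nat.le_mul_of_pos_right _ (by positivity)
  set D := ⌈3000 * ε⁻¹ ^ 2 * Real.log ((n : ℝ) * (ℓ : ℝ))⌉₊ with hDdef
  have hlog : 0 < Real.log ((n : ℝ) * (ℓ : ℝ)) := Real.log_pos (by exact_mod_cast hnℓ)
  have hD0 : 0 < D := Nat.ceil_pos.2 (by positivity)
  obtain ⟨f, hfZ, hfP⟩ := embed_exists (D := D) hnℓ P Z hPc hZc ε hε (by
    push_cast
    exact Nat.le_ceil _)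
  refine ⟨D, f, le_rfl, ?_⟩
  have hinj : Set.InjOn (PolyCurve.map f) (T : Set (PolyCurve d)) := by
    intro σ hσ τ hτ h
    by_cases hne : σ.toFun = τ.toFun
    · exact map_inj f σ τ hne h
    · obtain ⟨hz, t, ht⟩ := hw (σ, τ) hne
      exfalso
      refine hfZ (w (σ, τ)) (Finset.mem_image_of_mem _ (Finset.mem_product.2 ⟨hσ, hτ⟩)) hz ?_
      rw [ht, map_sub, sub_eq_zero]
      exact congrFun (congrArg PolyCurve.toFun h) t
  have hpt : ∀ σ ∈ S, ∀ τ ∈ S, ∀ s ∈ Set.Icc (0:ℝ) 1, ∀ t ∈ Set.Icc (0:ℝ) 1,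
      (1 - ε) * ‖σ.toFun s - τ.toFun t‖ ≤ ‖f (σ.toFun s) - f (τ.toFun t)‖ ∧
      ‖f (σ.toFun s) - f (τ.toFun t)‖ ≤ (1 + ε) * ‖σ.toFun s - τ.toFun t‖ := by
    intro σ hσ τ hτ s hs t ht
    obtain ⟨i, j, x, _, h1⟩ := σ.exists_seg s hs
    obtain ⟨i', j', y, _, h2⟩ := τ.exists_seg t ht
    rw [h1, h2]
    exact hfP _ (hPv σ hσ i) _ (hPv σ hσ j) _ (hPv τ hτ i') _ (hPv τ hτ j') x y
  have hup : ∀ σ ∈ S, ∀ τ ∈ S,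
      frechetDist (PolyCurve.map f σ) (PolyCurve.map f τ) ≤ (1 + ε) * frechetDist σ τ :=
    fun σ hσ τ hτ => fd_compare (by linarith) fun s hs t ht => (hpt σ hσ τ hτ s hs t ht).2
  have hlow : ∀ σ ∈ S, ∀ τ ∈ S,
      frechetDist σ τ ≤ (1 - ε)⁻¹ * frechetDist (PolyCurve.map f σ) (PolyCurve.map f τ) :=
    fun σ hσ τ hτ => fd_compare (inv_nonneg.2 (by linarith)) fun s hs t ht => by
      rw [le_inv_mul_iff₀ (by linarith)]
      exact (hpt σ hσ τ hτ s hs t ht).1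
  have hsum : ∀ C : Finset (PolyCurve D),
      ∑ τ ∈ T.image (PolyCurve.map f), sInf ((fun c => frechetDist τ c) '' ↑C)
        = ∑ τ ∈ T, sInf ((fun c => frechetDist (PolyCurve.map f τ) c) '' ↑C) :=
    fun C => Finset.sum_image hinj
  constructor
  · obtain ⟨C₀, _, hC₀k, hC₀m⟩ := exists_superset_card hD0 hℓ2 (∅ : Finset (PolyCurve D)) (k := k)
      (by simp) (by simp)
    refine le_csInf ⟨_, C₀, hC₀k, hC₀m, rfl⟩ ?_
    rintro _ ⟨C, hC1, hC2, rfl⟩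
    rw [hsum]
    choose a ham ha using fun τ : PolyCurve D => cost_attained τ C (Finset.card_pos.1 (by omega))
    choose rep hrepT hrep using fun c : PolyCurve D =>
      T.exists_min_image (fun ρ => frechetDist (PolyCurve.map f ρ) c) hTne
    obtain ⟨C', hs, hc, hm'⟩ := exists_superset_card hd hℓ2 (C.image rep) (k := k)
      (Finset.card_image_le.trans hC1.le) (by
        intro c hc
        obtain ⟨x, _, rfl⟩ := Finset.mem_image.1 hc
        exact hTℓ _ (hrepT x))
    have hle := kMedianCost_le T C' hc hm'
    refine (mul_le_mul_of_nonneg_left hle (by linarith)).trans ?_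
    rw [Finset.mul_sum]
    refine Finset.sum_le_sum fun τ hτ => ?_
    set F := PolyCurve.map f
    have h1 := cost_le τ C' (hs (Finset.mem_image_of_mem rep (ham (F τ))))
    have h2 := hlow τ (Finset.mem_union_left _ hτ) _ (Finset.mem_union_left _ (hrepT (a (F τ))))
    rw [le_inv_mul_iff₀ (by linarith)] at h2
    have h3 := fd_triangle (F τ) (a (F τ)) (F (rep (a (F τ))))
    have h4 := hrep (a (F τ)) τ hτ
    rw [fd_symm (a (F τ))] at h3
    have h5 := mul_le_mul_of_nonneg_left h1 (by linarith : 0 ≤ 1 - ε)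
    rw [← ha (F τ)]
    have h6 : frechetDist (F (rep (a (F τ)))) (a (F τ)) ≤ frechetDist (F τ) (a (F τ)) := h4
    linarith
  · obtain ⟨C', hs, hc, hm'⟩ := exists_superset_card hD0 hℓ2 (Cs.image (PolyCurve.map f)) (k := k)
      (Finset.card_image_le.trans hCk.le) (by
        intro c hc
        obtain ⟨x, hx, rfl⟩ := Finset.mem_image.1 hc
        exact hCm x hx)
    refine (kMedianCost_le _ C' hc hm').trans ?_
    rw [hsum, ← hCs, Finset.mul_sum]
    refine Finset.sum_le_sum fun τ hτ => ?_
    refine (cost_le _ C' (hs (Finset.mem_image_of_mem _ (hccm τ)))).trans ?_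
    rw [← hcc τ]
    exact hup τ (Finset.mem_union_left _ hτ) _ (Finset.mem_union_right _ (Finset.mem_image_of_mem _ hτ))

end
end
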